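/- For every C > 0 and every A > 0 there exist ε₀ > 0 and N such that the following holds for all n ≥ N, all integers k with |k − 2·log₂ n| ≤ C·log log n, and all integers r with 1 ≤ r ≤ ε₀·(log log n)/(log log log n). The probability that for some integer u with kr ≤ u ≤ (k+1)r there exists a u-element vertex subset of G_{n,1/2} whose induced subgraph is K_{r+1}-free and k^{3/4}-far from being r-partite is at most n^{−A}. -/

import Mathlib

open scoped Classical

/-- Probability of an event under the uniform measure on simple graphs on `Fin n`
(equivalently, `G_{n,1/2}`). -/
noncomputable def grPr (n : ℕ) (S : Set (SimpleGraph (Fin n))) : ℝ :=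
  ((PMF.uniformOfFintype (SimpleGraph (Fin n))).toOuterMeasure S).toReal

/-- The number of edges of `G` inside `s` that are monochromatic under the
`r`-coloring `f` (i.e. lie inside one of the parts of the partition induced by `f`). -/
noncomputable def monoEdgesIn {n r : ℕ} (G : SimpleGraph (Fin n)) (s : Finset (Fin n))
    (f : Fin n → Fin r) : ℕ :=
  {e ∈ G.edgeSet | (∀ v ∈ e, v ∈ s) ∧ ∃ c, ∀ v ∈ e, f v = c}.ncard

/-- The induced subgraph of `G` on `s` is `t`-far from being `r`-partite: every
partition of `s` into `r` parts leaves more than `t` edges inside the parts. -/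
def FarFromPartite {n : ℕ} (G : SimpleGraph (Fin n)) (s : Finset (Fin n)) (r : ℕ)
    (t : ℝ) : Prop :=
  ∀ f : Fin n → Fin r, t < (monoEdgesIn G s f : ℝ)

set_option linter.unusedSectionVars false

section Graphs

variable {V : Type*} [Fintype V] [DecidableEq V]

/-- The neighbourhood of a vertex, as a finset. -/
noncomputable def nbr (G : SimpleGraph V) (v : V) : Finset V :=
  Finset.univ.filter fun z => G.Adj v z

/-- The graph obtained by isolating the vertices of `J`. -/
def isolate (G : SimpleGraph V) (J : Finset V) : SimpleGraph V where
  Adj a b := G.Adj a b ∧ a ∉ J ∧ b ∉ J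
  symm := ⟨fun _ _ h => ⟨h.1.symm, h.2.2, h.2.1⟩⟩
  loopless := ⟨fun _ h => h.1.ne rfl⟩

/-- All edges of `G` lie inside `s`. -/
def LivesOn (s : Finset V) (G : SimpleGraph V) : Prop :=
  ∀ a b, G.Adj a b → a ∈ s

/-- The map `c` is a proper colouring of `G`. -/
def IsProper {r : ℕ} (G : SimpleGraph V) (c : V → Fin r) : Prop :=
  ∀ a b, G.Adj a b → c a ≠ c b

/-- Sets certified by at most `i` rounds of neighbourhood queries at vertices outside `S`. -/
noncomputable def certs (q f : ℕ) (s : Finset V) (G : SimpleGraph V) (S : Finset V) :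
    ℕ → Finset (Finset V)
  | 0 => (Fintype.piFinset fun _ : Fin f => s.insertNone).image
      fun g => s.filter fun v => ∀ j, g j ≠ some v
  | i + 1 => certs q f s G S i ∪
      (Fintype.piFinset fun _ : Fin q => (s \ S) ×ˢ certs q f s G S i).image
        fun p => Finset.univ.biUnion fun j => nbr G (p j).1 ∩ (p j).2

@[simp] lemma mem_nbr {G : SimpleGraph V} {v z : V} : z ∈ nbr G v ↔ G.Adj v z := by
  simp [nbr]

lemma LivesOn.nbr_subset {s : Finset V} {G : SimpleGraph V} (hG : LivesOn s G) (v : V) :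
    nbr G v ⊆ s := fun z hz => hG z v (mem_nbr.1 hz).symm

lemma LivesOn.isolate {s : Finset V} {G : SimpleGraph V} (hG : LivesOn s G) (J : Finset V) :
    LivesOn (s \ J) (isolate G J) := fun a b h => by
  simpa using ⟨hG a b h.1, h.2.1⟩

lemma isolate_isolate (G : SimpleGraph V) (J K : Finset V) :
    isolate (isolate G J) K = isolate G (J ∪ K) := by
  ext a b
  simp only [isolate, Finset.mem_union]
  tauto

lemma isolate_empty (G : SimpleGraph V) : isolate G ∅ = G := by
  ext a b
  simp [isolate]

lemma isolate_le (G : SimpleGraph V) (J : Finset V) : isolate G J ≤ G := fun _ _ h => h.1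

lemma certs_mono_level (q f : ℕ) (s : Finset V) (G : SimpleGraph V) (S : Finset V) {i j : ℕ}
    (h : i ≤ j) : certs q f s G S i ⊆ certs q f s G S j := by
  induction h with
  | refl => exact subset_rfl
  | step _ ih => exact ih.trans Finset.subset_union_left

lemma certs_anti (q f : ℕ) (s : Finset V) (G : SimpleGraph V) {S T : Finset V} (h : S ⊆ T)
    (i : ℕ) : certs q f s G T i ⊆ certs q f s G S i := by
  induction i with
  | zero => exact subset_rfl
  | succ i ih =>
    refine Finset.union_subset_union ih (Finset.image_subset_image ?_)
    exact Fintype.piFinset_subset _ _ fun _ =>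
      Finset.product_subset_product (Finset.sdiff_subset_sdiff subset_rfl h) ih

lemma certs_subset {q f : ℕ} {s : Finset V} {G : SimpleGraph V} {S : Finset V}
    (hG : LivesOn s G) {i : ℕ} {R : Finset V} (hR : R ∈ certs q f s G S i) : R ⊆ s := by
  induction i with
  | zero =>
    obtain ⟨g, -, rfl⟩ := Finset.mem_image.1 hR
    exact Finset.filter_subset _ _
  | succ i ih =>
    rcases Finset.mem_union.1 hR with h | h
    · exact ih h
    · obtain ⟨p, -, rfl⟩ := Finset.mem_image.1 h
      exact Finset.biUnion_subset.2 fun j _ =>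
        Finset.inter_subset_left.trans (hG.nbr_subset _)

lemma sdiff_mem_certs {q f : ℕ} {s : Finset V} (G : SimpleGraph V) (S : Finset V)
    {M : Finset V} (hM : M ⊆ s) (hc : M.card ≤ f) (i : ℕ) : s \ M ∈ certs q f s G S i := by
  refine certs_mono_level q f s G S (Nat.zero_le i) ?_
  refine Finset.mem_image.2 ⟨fun j => if hj : j.1 < M.card then
    some (M.equivFin.symm ⟨j.1, hj⟩ : V) else none, ?_, ?_⟩
  · refine Fintype.mem_piFinset.2 fun j => ?_
    by_cases hj : j.1 < M.card
    · simp only [hj, dite_true, Finset.some_mem_insertNone]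
      exact hM (M.equivFin.symm ⟨j.1, hj⟩).2
    · simp [hj]
  · ext v
    simp only [Finset.mem_filter, Finset.mem_sdiff]
    refine and_congr_right fun _ => ⟨fun h hv => ?_, fun hv j => ?_⟩
    · have := h ⟨(M.equivFin ⟨v, hv⟩).1, (M.equivFin ⟨v, hv⟩).2.trans_le hc⟩
      simp at this
    · by_cases hj : j.1 < M.card
      · simp only [hj, dite_true, ne_eq, Option.some.injEq]
        rintro rfl
        exact hv (M.equivFin.symm ⟨j.1, hj⟩).2
      · simp [hj]

lemma biUnion_mem_certs {q f : ℕ} {s : Finset V} {G : SimpleGraph V} {S Q : Finset V} {i : ℕ}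
    (hQ : Q.card = q) (hQs : Q ⊆ s \ S) {ρ : V → Finset V}
    (hρ : ∀ y ∈ Q, ρ y ∈ certs q f s G S i) :
    (Q.biUnion fun y => nbr G y ∩ ρ y) ∈ certs q f s G S (i + 1) := by
  refine Finset.mem_union_right _ (Finset.mem_image.2 ?_)
  let e : Fin q ≃ Q := (Q.equivFinOfCardEq hQ).symm
  refine ⟨fun j => ((e j : V), ρ (e j)), Fintype.mem_piFinset.2 fun j =>
    Finset.mem_product.2 ⟨hQs (e j).2, hρ _ (e j).2⟩, ?_⟩
  ext z
  simp only [Finset.mem_biUnion, Finset.mem_univ, true_and]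
  constructor
  · rintro ⟨j, hj⟩
    exact ⟨e j, (e j).2, hj⟩
  · rintro ⟨y, hy, hz⟩
    exact ⟨e.symm ⟨y, hy⟩, by simpa using hz⟩

lemma exists_certs_isolate {q f : ℕ} {s : Finset V} {G : SimpleGraph V} {S : Finset V} {i : ℕ}
    {R : Finset V} (hR : R ∈ certs q f s G S i) :
    ∃ R' ∈ certs q f s (isolate G S) S i, R' \ S = R \ S := by
  induction i generalizing R with
  | zero => exact ⟨R, hR, rfl⟩
  | succ i ih =>
    rcases Finset.mem_union.1 hR with h | h
    · obtain ⟨R', h1, h2⟩ := ih h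
      exact ⟨R', Finset.mem_union_left _ h1, h2⟩
    · obtain ⟨p, hp, rfl⟩ := Finset.mem_image.1 h
      have hp' := fun j => Finset.mem_product.1 (Fintype.mem_piFinset.1 hp j)
      choose ρ h1 h2 using fun j => ih (hp' j).2
      refine ⟨_, Finset.mem_union_right _ (Finset.mem_image.2 ⟨fun j => ((p j).1, ρ j),
        Fintype.mem_piFinset.2 fun j => Finset.mem_product.2 ⟨(hp' j).1, h1 j⟩, rfl⟩), ?_⟩
      ext z
      simp only [Finset.mem_sdiff, Finset.mem_biUnion, Finset.mem_univ, true_and,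
        Finset.mem_inter, mem_nbr]
      refine and_congr_left fun hz => exists_congr fun j => ?_
      have hy := (Finset.mem_sdiff.1 (hp' j).1).2
      have h3 := Finset.ext_iff.1 (h2 j) z
      simp only [Finset.mem_sdiff, hz, not_false_eq_true, and_true] at h3
      simp [isolate, hy, hz, h3]

lemma card_certs_le {q f : ℕ} (hq : 1 ≤ q) (hf : 1 ≤ f) {s : Finset V} (hs : s.Nonempty)
    (G : SimpleGraph V) (S : Finset V) (i : ℕ) :
    (certs q f s G S i).card ≤ (s.card + 1) ^ ((3 * q) ^ i * f) := by
  induction i with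
  | zero =>
    refine Finset.card_image_le.trans ?_
    simp
  | succ i ih =>
    set W := s.card + 1
    set b := (3 * q) ^ i * f
    have hb : 1 ≤ b := Nat.one_le_iff_ne_zero.2 (by positivity)
    have hW : 2 ≤ W := by have := hs.card_pos; omega
    have h2 : ((Fintype.piFinset fun _ : Fin q => (s \ S) ×ˢ certs q f s G S i).image
        fun p => Finset.univ.biUnion fun j => nbr G (p j).1 ∩ (p j).2).card ≤
        W ^ (q * (1 + b)) := by
      refine Finset.card_image_le.trans ?_
      simp only [Fintype.card_piFinset, Finset.card_product, Finset.prod_const, Finset.card_univ,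
        Fintype.card_fin]
      rw [mul_comm q, pow_mul, pow_add, pow_one]
      refine Nat.pow_le_pow_left (Nat.mul_le_mul ?_ ih) _
      exact (Finset.card_le_card Finset.sdiff_subset).trans (Nat.le_succ _)
    calc (certs q f s G S (i + 1)).card ≤ W ^ b + W ^ (q * (1 + b)) :=
          (Finset.card_union_le _ _).trans (add_le_add ih h2)
      _ ≤ W ^ (q * (1 + b)) + W ^ (q * (1 + b)) := by
          gcongr
          · omega
          · nlinarith
      _ = 2 * W ^ (q * (1 + b)) := by ring
      _ ≤ W * W ^ (q * (1 + b)) := by gcongr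
      _ = W ^ (q * (1 + b) + 1) := by ring
      _ ≤ W ^ ((3 * q) ^ (i + 1) * f) := by
          refine Nat.pow_le_pow_right (by omega) ?_
          have : (3 * q) ^ (i + 1) * f = 3 * q * b := by simp only [b]; ring
          rw [this]
          nlinarith [Nat.mul_le_mul hq hb]

end Graphs

section Structure

variable {V : Type*} [Fintype V] [DecidableEq V]

/-- The rows of the vertices of `Q` avoid unusually large parts of their certified sets. -/
def BadRows (q f r : ℕ) (h : ℝ) (s : Finset V) (G : SimpleGraph V) (Q : Finset V) : Prop :=
  Q ⊆ s ∧ Q.card = q ∧ ∃ ρ : V → Finset V, (∀ y ∈ Q, ρ y ∈ certs q f s G Q r) ∧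
    ∃ R ⊆ s, ∀ y ∈ Q, nbr G y ⊆ R ∪ (s \ ρ y) ∧
      ((R ∪ (s \ ρ y)).card : ℝ) ≤ (1 - 1 / (r : ℝ)) * s.card - h

/-- The row of `x` avoids a certified set of more than `s.card / r + r * h` vertices. -/
def BadVertex (q f r : ℕ) (h : ℝ) (s : Finset V) (G : SimpleGraph V) (x : V) : Prop :=
  x ∈ s ∧ ∃ R₁ ∈ certs q f s G {x} r, ∃ R₂ ∈ certs q f s G {x} r,
    Disjoint (nbr G x) (R₁ ∪ R₂) ∧ (s.card : ℝ) / r + r * h ≤ (R₁ ∪ R₂).card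

/-- The rows of `x` and `y` are jointly disjoint on a large certified set outside the certified
sets avoided by `x` or by `y`. -/
def BadPair (q f r : ℕ) (h : ℝ) (s : Finset V) (G : SimpleGraph V) (x y : V) : Prop :=
  x ∈ s ∧ y ∈ s ∧ x ≠ y ∧ ∃ A ∈ certs q f s G {x, y} r, ∃ B ∈ certs q f s G {x, y} r,
    ∃ D ∈ certs q f s G {x, y} r, Disjoint (nbr G x) A ∧ Disjoint (nbr G y) B ∧
      Disjoint (nbr G x ∩ nbr G y) D ∧ (s.card : ℝ) / r - r * h ≤ A.card ∧
      (s.card : ℝ) / r - r * h ≤ B.card ∧ 10 * r * h ≤ (D \ (A ∪ B)).card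

lemma exists_cert_rich_or_poor {q f r : ℕ} {h : ℝ} {s : Finset V} {G : SimpleGraph V}
    (hG : LivesOn s G) (hr : 1 ≤ r) (hh : 0 ≤ h) (hf : (f : ℝ) ≤ h)
    (hbad : ∀ Q, ¬ BadRows q f r h s G Q) (i : ℕ) (hi : i ≤ r) (S M : Finset V)
    (hM : M ⊆ s) (hS : S.card + 2 * q * i ≤ f) :
    (∃ R ∈ certs q f s G S i, (1 - (i : ℝ) / r) * s.card - i * h ≤ R.card ∧
      ∀ z ∈ R, ∃ K, G.IsNClique i K ∧ K ⊆ M ∧ K ⊆ nbr G z) ∨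
    (∃ R ∈ certs q f s G S i, (1 - ((i : ℝ) - 1) / r) * s.card - i * h ≤ R.card ∧
      Disjoint R M) := by
  have hr0 : (0 : ℝ) < r := by exact_mod_cast hr
  induction i generalizing S M with
  | zero =>
    left
    refine ⟨s, ?_, by simp, fun z _ => ⟨∅, ?_, by simp, by simp⟩⟩
    · simpa using sdiff_mem_certs (q := q) (f := f) G S (Finset.empty_subset s) (by simp) 0
    · simp [SimpleGraph.isNClique_iff]
  | succ i ih =>
    have hsize : ∀ ρ : Finset V, ρ ⊆ s → (s \ ρ).card + ρ.card = s.card :=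
      fun ρ h => Finset.card_sdiff_add_card_eq_card h
    by_cases hsmall : (M \ S).card < 2 * q
    · right
      have hMc : M.card ≤ f := by
        have h1 : M.card ≤ (M \ S).card + S.card := by
          rw [← Finset.card_sdiff_add_card_inter M S]
          exact Nat.add_le_add_left (Finset.card_le_card Finset.inter_subset_right) _
        have : 2 * q ≤ 2 * q * (i + 1) := Nat.le_mul_of_pos_right _ (by omega)
        omega
      refine ⟨s \ M, sdiff_mem_certs G S hM hMc _, ?_, Finset.sdiff_disjoint⟩
      have h1 : ((s \ M).card : ℝ) + M.card = s.card := by exact_mod_cast hsize M hM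
      have h2 : (M.card : ℝ) ≤ f := by exact_mod_cast hMc
      have h3 : 0 ≤ (i : ℝ) / r * s.card := by positivity
      have h4 : 0 ≤ (i : ℝ) * h := by positivity
      push_cast
      rw [add_sub_cancel_right]
      linarith
    · push Not at hsmall
      obtain ⟨Q', hQ's, hQ'c⟩ := Finset.exists_subset_card_eq hsmall
      have key := fun y => ih (by omega) (S ∪ Q') (M ∩ nbr G y)
        (Finset.inter_subset_left.trans hM) (by
          have := Finset.card_union_le S Q'
          have : 2 * q * (i + 1) = 2 * q * i + 2 * q := by ring
          omega)
      have step : ∀ (Q : Finset V) (ρ : V → Finset V) (a : ℝ), Q ⊆ Q' → Q.card = q →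
          (∀ y ∈ Q, ρ y ∈ certs q f s G (S ∪ Q') i) →
          (∀ y ∈ Q, a * s.card - i * h ≤ (ρ y).card) →
          (Q.biUnion fun y => nbr G y ∩ ρ y) ∈ certs q f s G S (i + 1) ∧
          (a - 1 / r) * s.card - (i + 1) * h ≤ (Q.biUnion fun y => nbr G y ∩ ρ y).card := by
        intro Q ρ a hQ hQc hρ ha
        refine ⟨biUnion_mem_certs hQc ?_ fun y hy => certs_anti q f s G
          Finset.subset_union_left i (hρ y hy), ?_⟩
        · exact hQ.trans (hQ's.trans (Finset.sdiff_subset_sdiff hM subset_rfl))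
        · by_contra hlt
          push Not at hlt
          refine hbad Q ⟨hQ.trans (hQ's.trans (Finset.sdiff_subset.trans hM)), hQc, ρ,
            fun y hy => certs_mono_level q f s G Q (by omega : i ≤ r) (certs_anti q f s G
              (hQ.trans Finset.subset_union_right) i (hρ y hy)),
            Q.biUnion fun y => nbr G y ∩ ρ y, ?_, fun y hy => ⟨?_, ?_⟩⟩
          · exact Finset.biUnion_subset.2 fun y _ =>
              Finset.inter_subset_left.trans (hG.nbr_subset y)
          · intro z hz
            by_cases hzρ : z ∈ ρ y
            · exact Finset.mem_union_left _ (Finset.mem_biUnion.2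
                ⟨y, hy, Finset.mem_inter.2 ⟨hz, hzρ⟩⟩)
            · exact Finset.mem_union_right _ (Finset.mem_sdiff.2 ⟨hG.nbr_subset y hz, hzρ⟩)
          · have h1 : ((s \ ρ y).card : ℝ) + (ρ y).card = s.card := by
              exact_mod_cast hsize _ (certs_subset hG (hρ y hy))
            have h2 : (((Q.biUnion fun y => nbr G y ∩ ρ y) ∪ (s \ ρ y)).card : ℝ) ≤
                (Q.biUnion fun y => nbr G y ∩ ρ y).card + (s \ ρ y).card := by
              exact_mod_cast Finset.card_union_le _ _
            have h3 := ha y hy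
            linarith
      set P : V → Prop := fun y => ∃ R ∈ certs q f s G (S ∪ Q') i,
        (1 - (i : ℝ) / r) * s.card - i * h ≤ R.card ∧
          ∀ z ∈ R, ∃ K, G.IsNClique i K ∧ K ⊆ M ∩ nbr G y ∧ K ⊆ nbr G z with hP
      have hsplit := Finset.card_filter_add_card_filter_not (s := Q') P
      by_cases hc : q ≤ (Q'.filter P).card
      · left
        obtain ⟨Q, hQ, hQc⟩ := Finset.exists_subset_card_eq hc
        have hQP : ∀ y ∈ Q, P y := fun y hy => (Finset.mem_filter.1 (hQ hy)).2
        choose! ρ h1 h2 h3 using hQP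
        obtain ⟨h4, h5⟩ := step Q ρ _ (hQ.trans (Finset.filter_subset _ _)) hQc h1 h2
        refine ⟨_, h4, ?_, ?_⟩
        · push_cast
          convert h5 using 2
          ring
        · intro z hz
          obtain ⟨y, hy, hz⟩ := Finset.mem_biUnion.1 hz
          obtain ⟨hzy, hzρ⟩ := Finset.mem_inter.1 hz
          obtain ⟨K, hK, hKM, hKz⟩ := h3 y hy z hzρ
          refine ⟨insert y K, hK.insert fun b hb => ?_, ?_, ?_⟩
          · exact mem_nbr.1 (Finset.mem_inter.1 (hKM hb)).2
          · refine Finset.insert_subset ?_ (hKM.trans Finset.inter_subset_left)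
            exact (Finset.mem_sdiff.1 (hQ's (Finset.mem_filter.1 (hQ hy)).1)).1
          · exact Finset.insert_subset (mem_nbr.2 (mem_nbr.1 hzy).symm) hKz
      · right
        have hc' : q ≤ (Q'.filter fun y => ¬ P y).card := by omega
        obtain ⟨Q, hQ, hQc⟩ := Finset.exists_subset_card_eq hc'
        have hQP : ∀ y ∈ Q, ∃ R ∈ certs q f s G (S ∪ Q') i,
            (1 - ((i : ℝ) - 1) / r) * s.card - i * h ≤ R.card ∧ Disjoint R (M ∩ nbr G y) :=
          fun y hy => (key y).resolve_left (Finset.mem_filter.1 (hQ hy)).2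
        choose! ρ h1 h2 h3 using hQP
        obtain ⟨h4, h5⟩ := step Q ρ _ (hQ.trans (Finset.filter_subset _ _)) hQc h1 h2
        refine ⟨_, h4, ?_, ?_⟩
        · push_cast
          convert h5 using 2
          ring
        · refine (Finset.disjoint_biUnion_left _ _ _).2 fun y hy => ?_
          rw [Finset.disjoint_left]
          intro z hz hzM
          obtain ⟨hzy, hzρ⟩ := Finset.mem_inter.1 hz
          exact Finset.disjoint_left.1 (h3 y hy) hzρ (Finset.mem_inter.2 ⟨hzM, hzy⟩)

lemma le_card_biUnion_of_pairwise {ι : Type*} {X : Finset ι} {R : ι → Finset V} {a d : ℝ}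
    (hd : 0 ≤ d) (ha : ∀ x ∈ X, a ≤ (R x).card)
    (hX : ∀ x ∈ X, ∀ y ∈ X, x ≠ y → ((R x ∩ R y).card : ℝ) ≤ d) :
    X.card * a - X.card ^ 2 * d ≤ (X.biUnion R).card := by
  induction X using Finset.induction_on with
  | empty => simp
  | insert x X hx ih =>
    have ih' := ih (fun y hy => ha y (Finset.mem_insert_of_mem hy)) fun y hy z hz =>
      hX y (Finset.mem_insert_of_mem hy) z (Finset.mem_insert_of_mem hz)
    have h1 := Finset.card_union_add_card_inter (R x) (X.biUnion R)
    have h2 : ((R x ∩ X.biUnion R).card : ℝ) ≤ X.card * d := by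
      rw [Finset.inter_biUnion]
      calc ((X.biUnion fun y => R x ∩ R y).card : ℝ) ≤ ∑ y ∈ X, ((R x ∩ R y).card : ℝ) := by
            exact_mod_cast Finset.card_biUnion_le
        _ ≤ ∑ y ∈ X, d := Finset.sum_le_sum fun y hy => hX x (Finset.mem_insert_self _ _) y
            (Finset.mem_insert_of_mem hy) (by rintro rfl; exact hx hy)
        _ = X.card * d := by simp
    have h3 := ha x (Finset.mem_insert_self _ _)
    rw [Finset.biUnion_insert, Finset.card_insert_of_notMem hx]
    have h4 : ((R x ∪ X.biUnion R).card : ℝ) + (R x ∩ X.biUnion R).card =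
        (R x).card + (X.biUnion R).card := by exact_mod_cast h1
    push_cast
    have h5 : (0 : ℝ) ≤ X.card * d := by positivity
    nlinarith

end Structure

section Structure

variable {V : Type*} [Fintype V] [DecidableEq V]

lemma cliqueFree_no_extension {r : ℕ} (hr : 1 ≤ r) {G : SimpleGraph V}
    (hG : G.CliqueFree (r + 1)) {x z : V} {K : Finset V} (hK : G.IsNClique (r - 1) K)
    (hx : K ⊆ nbr G x) (hz : K ⊆ nbr G z) : ¬ G.Adj x z := by
  intro hxz
  have h1 : G.IsNClique (r - 1 + 1) (insert z K) := hK.insert fun b hb => mem_nbr.1 (hz hb)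
  have h2 : G.IsNClique (r - 1 + 1 + 1) (insert x (insert z K)) := h1.insert fun b hb => by
    rcases Finset.mem_insert.1 hb with rfl | hb
    · exact hxz
    · exact mem_nbr.1 (hx hb)
  rw [show r - 1 + 1 + 1 = r + 1 by omega] at h2
  exact hG _ h2

lemma exists_proper_of_near_or_apart {r : ℕ} (hr : 1 ≤ r) {G : SimpleGraph V} {s : Finset V}
    (hG : LivesOn s G) (R : V → Finset V) (hRs : ∀ x ∈ s, R x ⊆ s) {a d e : ℝ} (hd : 0 ≤ d)
    (ha : ∀ x ∈ s, a ≤ (R x).card)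
    (hpair : ∀ x ∈ s, ∀ y ∈ s, x ≠ y →
      (((R x \ R y).card : ℝ) ≤ e ∧ ¬ G.Adj x y) ∨ ((R x ∩ R y).card : ℝ) ≤ d)
    (he : 0 ≤ e) (h1 : (s.card : ℝ) < (r + 1) * a - (r + 1) ^ 2 * d) (h2 : d + 2 * e < a) :
    ∃ c : V → Fin r, IsProper G c := by
  set T := s.powerset.filter fun X => ∀ x ∈ X, ∀ y ∈ X, x ≠ y → ((R x ∩ R y).card : ℝ) ≤ d
  have hT : T.Nonempty := ⟨∅, by simp [T]⟩
  obtain ⟨X, hXT, hmax⟩ := Finset.exists_max_image T Finset.card hT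
  obtain ⟨hXs, hX⟩ := Finset.mem_filter.1 hXT
  rw [Finset.mem_powerset] at hXs
  have hXr : X.card ≤ r := by
    by_contra hlt
    obtain ⟨Y, hYX, hY⟩ := Finset.exists_subset_card_eq (show r + 1 ≤ X.card by omega)
    have h3 := le_card_biUnion_of_pairwise (X := Y) (R := R) hd (fun x hx => ha x (hXs (hYX hx)))
      fun x hx y hy => hX x (hYX hx) y (hYX hy)
    have h4 : ((Y.biUnion R).card : ℝ) ≤ s.card := by
      exact_mod_cast Finset.card_le_card (Finset.biUnion_subset.2 fun x hx =>
        hRs x (hXs (hYX hx)))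
    rw [hY] at h3
    push_cast at h3
    linarith
  have hcol : ∀ v ∈ s, ∃ x ∈ X, ((R x \ R v).card : ℝ) ≤ e := by
    intro v hv
    by_cases hvX : v ∈ X
    · exact ⟨v, hvX, by simpa using he⟩
    by_contra! hno
    have : insert v X ∈ T := by
      refine Finset.mem_filter.2 ⟨Finset.mem_powerset.2 (Finset.insert_subset hv hXs), ?_⟩
      have hv' : ∀ y ∈ X, ((R y ∩ R v).card : ℝ) ≤ d := fun y hy =>
        (hpair y (hXs hy) v hv (by rintro rfl; exact hvX hy)).resolve_left
          fun h => absurd h.1 (not_le.2 (hno y hy))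
      intro x hx y hy hxy
      rcases Finset.mem_insert.1 hx with rfl | hx' <;>
        rcases Finset.mem_insert.1 hy with rfl | hy'
      · exact absurd rfl hxy
      · rw [Finset.inter_comm]; exact hv' y hy'
      · exact hv' x hx'
      · exact hX x hx' y hy' hxy
    have := hmax _ this
    rw [Finset.card_insert_of_notMem hvX] at this
    omega
  have hfin : Nonempty (X ↪ Fin r) := by
    refine ⟨(Fintype.equivFin X).toEmbedding.trans (Fin.castLEEmb ?_)⟩
    simpa using hXr
  obtain ⟨g⟩ := hfin
  choose! φ hφ1 hφ2 using hcol
  refine ⟨fun v => if hv : v ∈ s then g ⟨φ v, hφ1 v hv⟩ else ⟨0, hr⟩, fun u v huv hc => ?_⟩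
  have hu : u ∈ s := hG u v huv
  have hv : v ∈ s := hG v u huv.symm
  simp only [hu, hv, dite_true, EmbeddingLike.apply_eq_iff_eq, Subtype.mk.injEq] at hc
  have e1 := hφ2 u hu
  have e2 := hφ2 v hv
  rw [hc] at e1
  have hbig : a - 2 * e ≤ (R u ∩ R v).card := by
    have h3 : (R (φ v)).card ≤ (R u ∩ R v).card + (R (φ v) \ R u).card + (R (φ v) \ R v).card := by
      refine le_trans (Finset.card_le_card ?_) ((Finset.card_union_le _ _).trans
        (Nat.add_le_add_right (Finset.card_union_le _ _) _))
      intro z hz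
      simp only [Finset.mem_union, Finset.mem_inter, Finset.mem_sdiff, hz, true_and]
      tauto
    have h3' : ((R (φ v)).card : ℝ) ≤
        (R u ∩ R v).card + (R (φ v) \ R u).card + (R (φ v) \ R v).card := by exact_mod_cast h3
    have := ha _ (hXs (hφ1 v hv))
    linarith
  rcases hpair u hu v hv huv.ne with h | h
  · exact h.2 huv
  · linarith

lemma exists_proper_of_not_bad {q f r : ℕ} {h : ℝ} {s : Finset V} {G : SimpleGraph V}
    (hG : LivesOn s G) (hfree : G.CliqueFree (r + 1)) (hr : 1 ≤ r) (hq : 1 ≤ q)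
    (hf : f = 2 * q * r) (hfh : (f : ℝ) ≤ h) (hh : 100 * (r : ℝ) ^ 4 * h = s.card)
    (hrows : ∀ Q, ¬ BadRows q f r h s G Q) (hvert : ∀ x, ¬ BadVertex q f r h s G x)
    (hpairs : ∀ x y, ¬ BadPair q f r h s G x y) :
    ∃ c : V → Fin r, IsProper G c := by
  have hr0 : (1 : ℝ) ≤ r := by exact_mod_cast hr
  have hh0 : 0 < h := by
    refine lt_of_lt_of_le ?_ hfh
    have : 0 < f := by rw [hf]; positivity
    exact_mod_cast this
  set w : ℝ := (s.card : ℝ) with hw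
  have hcast : ((r - 1 : ℕ) : ℝ) = r - 1 := by push_cast [hr]; ring
  have hwr : w / r = 100 * (r : ℝ) ^ 3 * h := by
    rw [← hh]; field_simp
  have key : ∀ M ⊆ s, ∀ x y : V,
      (∃ R ∈ certs q f s G {x, y} (r - 1), w / r - r * h ≤ R.card ∧
      ∀ z ∈ R, ∃ K, G.IsNClique (r - 1) K ∧ K ⊆ M ∧ K ⊆ nbr G z) ∨
    (∃ R ∈ certs q f s G {x, y} (r - 1), 2 * (w / r) - r * h ≤ R.card ∧ Disjoint R M) := by
    intro M hM x y
    have h2 : ({x, y} : Finset V).card ≤ 2 := Finset.card_le_two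
    have hs : ({x, y} : Finset V).card + 2 * q * (r - 1) ≤ f := by
      obtain ⟨r', rfl⟩ : ∃ r', r = r' + 1 := ⟨r - 1, by omega⟩
      rw [hf]
      simp only [Nat.add_sub_cancel]
      nlinarith
    have hrne : (r : ℝ) ≠ 0 := by positivity
    rcases exists_cert_rich_or_poor hG hr hh0.le hfh hrows (r - 1) (by omega) {x, y} M hM hs with
      ⟨R, h3, h4, h5⟩ | ⟨R, h3, h4, h5⟩
    · refine Or.inl ⟨R, h3, le_trans ?_ h4, h5⟩
      rw [hcast]
      have : (1 - ((r : ℝ) - 1) / r) * w = w / r := by field_simp; ring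
      change _ ≤ (1 - ((r : ℝ) - 1) / r) * w - _
      rw [this]
      nlinarith
    · refine Or.inr ⟨R, h3, le_trans ?_ h4, h5⟩
      rw [hcast]
      have : (1 - ((r : ℝ) - 1 - 1) / r) * w = 2 * (w / r) := by field_simp; ring
      change _ ≤ (1 - ((r : ℝ) - 1 - 1) / r) * w - _
      rw [this]
      nlinarith
  have hlev : ∀ S, certs q f s G S (r - 1) ⊆ certs q f s G S r :=
    fun S => certs_mono_level q f s G S (by omega)
  have hxy : ∀ x y : V, certs q f s G {x, y} r ⊆ certs q f s G {x} r :=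
    fun x y => certs_anti q f s G (by simp) r
  have hself : ∀ x ∈ s, ∀ y, ∃ R ∈ certs q f s G {x, y} r, w / r - r * h ≤ R.card ∧
      Disjoint (nbr G x) R := by
    intro x hx y
    rcases key (nbr G x) (hG.nbr_subset x) x y with ⟨R, h3, h4, h5⟩ | ⟨R, h3, h4, h5⟩
    · refine ⟨R, hlev _ h3, h4, Finset.disjoint_left.2 fun z hzx hzR => ?_⟩
      obtain ⟨K, hK, hKx, hKz⟩ := h5 z hzR
      exact cliqueFree_no_extension hr hfree hK hKx hKz (mem_nbr.1 hzx)
    · exfalso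
      refine hvert x ⟨hx, R, hxy x y (hlev _ h3), R, hxy x y (hlev _ h3), ?_, ?_⟩
      · rw [Finset.union_self]; exact h5.symm
      · rw [Finset.union_self]
        refine le_trans ?_ h4
        change w / r + r * h ≤ _
        have : 2 * (r * h) ≤ w / r := by
          rw [hwr]
          have : (r : ℝ) ≤ r ^ 3 := le_self_pow₀ hr0 (by norm_num)
          nlinarith [mul_le_mul_of_nonneg_right this hh0.le, mul_pos (by positivity : (0:ℝ) < r ^ 3) hh0]
        linarith
  choose! P hP1 hP2 hP3 using hself
  have hclose : ∀ x ∈ s, ∀ A ∈ certs q f s G {x} r, ∀ B ∈ certs q f s G {x} r,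
      Disjoint (nbr G x) A → Disjoint (nbr G x) B → w / r - r * h ≤ B.card →
      ((A \ B).card : ℝ) ≤ 2 * r * h ∧ (A.card : ℝ) ≤ w / r + r * h := by
    intro x hx A hA B hB hdA hdB hBc
    have h3 : ((A ∪ B).card : ℝ) < w / r + r * h := by
      by_contra hlt
      push Not at hlt
      exact hvert x ⟨hx, A, hA, B, hB, Finset.disjoint_union_right.2 ⟨hdA, hdB⟩, hlt⟩
    have h4 : ((A \ B).card : ℝ) + B.card = (A ∪ B).card := by
      exact_mod_cast Finset.card_sdiff_add_card A B
    have h5 : (A.card : ℝ) ≤ (A ∪ B).card := by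
      exact_mod_cast Finset.card_le_card Finset.subset_union_left
    constructor <;> linarith
  have hdiag : ∀ x ∈ s, P x x ∈ certs q f s G {x} r := fun x hx => by
    simpa using hP1 x hx x
  refine exists_proper_of_near_or_apart hr hG (fun x => P x x)
    (fun x hx => certs_subset hG (hdiag x hx)) (a := w / r - r * h) (d := 17 * r * h)
    (e := 4 * r * h) (by positivity) (fun x hx => hP2 x hx x) ?_ (by positivity) ?_ ?_
  · intro x hx y hy hne
    have hRx := hxy x y (hP1 x hx y)
    have hRy := hxy y x (hP1 y hy x)
    have hRy' : P y x ∈ certs q f s G {x, y} r := by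
      rw [Finset.pair_comm]; exact hP1 y hy x
    rcases key (nbr G x ∩ nbr G y) (Finset.inter_subset_left.trans (hG.nbr_subset x)) x y with
      ⟨R, h3, h4, h5⟩ | ⟨R, h3, h4, h5⟩
    · left
      have hR := hlev _ h3
      have hR' : R ∈ certs q f s G {y, x} r := by rw [Finset.pair_comm]; exact hR
      have hdx : Disjoint (nbr G x) R := Finset.disjoint_left.2 fun z hzx hzR => by
        obtain ⟨K, hK, hKx, hKz⟩ := h5 z hzR
        exact cliqueFree_no_extension hr hfree hK (hKx.trans Finset.inter_subset_left) hKz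
          (mem_nbr.1 hzx)
      have hdy : Disjoint (nbr G y) R := Finset.disjoint_left.2 fun z hzx hzR => by
        obtain ⟨K, hK, hKx, hKz⟩ := h5 z hzR
        exact cliqueFree_no_extension hr hfree hK (hKx.trans Finset.inter_subset_right) hKz
          (mem_nbr.1 hzx)
      constructor
      · have e1 := (hclose x hx _ (hdiag x hx) R (hxy x y hR) (hP3 x hx x) hdx h4).1
        have e2 := (hclose y hy R (hxy y x hR') _ (hdiag y hy) hdy (hP3 y hy y)
          (hP2 y hy y)).1
        have e3 : (P x x \ P y y).card ≤ (P x x \ R).card + (R \ P y y).card := by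
          refine (Finset.card_le_card ?_).trans (Finset.card_union_le _ _)
          intro z
          simp only [Finset.mem_union, Finset.mem_sdiff]
          tauto
        have e3' : ((P x x \ P y y).card : ℝ) ≤ (P x x \ R).card + (R \ P y y).card := by
          exact_mod_cast e3
        linarith
      · have hRne : R.Nonempty := by
          rw [← Finset.card_pos]
          have : (0 : ℝ) < w / r - r * h := by
            rw [hwr]
            have : (r : ℝ) ≤ r ^ 3 := le_self_pow₀ hr0 (by norm_num)
            nlinarith [mul_le_mul_of_nonneg_right this hh0.le,
              mul_pos (by positivity : (0:ℝ) < r ^ 3) hh0]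
          exact_mod_cast this.trans_le h4
        obtain ⟨z, hz⟩ := hRne
        obtain ⟨K, hK, hKx, -⟩ := h5 z hz
        exact cliqueFree_no_extension hr hfree hK (hKx.trans Finset.inter_subset_left)
          (hKx.trans Finset.inter_subset_right)
    · right
      have hD : ((R \ (P x y ∪ P y x)).card : ℝ) < 10 * r * h := by
        by_contra hlt
        push Not at hlt
        exact hpairs x y ⟨hx, hy, hne, P x y, hP1 x hx y, P y x, hRy', R, hlev _ h3,
          hP3 x hx y, hP3 y hy x, h5.symm, hP2 x hx y, hP2 y hy x, hlt⟩
      have e1 := hclose x hx _ hRx _ (hdiag x hx) (hP3 x hx y) (hP3 x hx x) (hP2 x hx x)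
      have e2 := hclose y hy _ hRy _ (hdiag y hy) (hP3 y hy x) (hP3 y hy y) (hP2 y hy y)
      have e3 := (hclose x hx _ (hdiag x hx) _ hRx (hP3 x hx x) (hP3 x hx y) (hP2 x hx y)).1
      have e4 := (hclose y hy _ (hdiag y hy) _ hRy (hP3 y hy y) (hP3 y hy x) (hP2 y hy x)).1
      have e5 : ((P x y ∪ P y x).card : ℝ) + (P x y ∩ P y x).card =
          (P x y).card + (P y x).card := by exact_mod_cast Finset.card_union_add_card_inter _ _
      have e6 : (R.card : ℝ) ≤ (R \ (P x y ∪ P y x)).card + (P x y ∪ P y x).card := by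
        have := Finset.card_le_card (Finset.subset_union_left (s₁ := R) (s₂ := P x y ∪ P y x))
        rw [← Finset.card_sdiff_add_card] at this
        exact_mod_cast this
      have e7 : ((P x x ∩ P y y).card : ℝ) ≤
          (P x y ∩ P y x).card + (P x x \ P x y).card + (P y y \ P y x).card := by
        have : (P x x ∩ P y y).card ≤
            (P x y ∩ P y x).card + (P x x \ P x y).card + (P y y \ P y x).card := by
          refine le_trans (Finset.card_le_card ?_) ((Finset.card_union_le _ _).trans
            (Nat.add_le_add_right (Finset.card_union_le _ _) _))
          intro z
          simp only [Finset.mem_union, Finset.mem_sdiff, Finset.mem_inter]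
          tauto
        exact_mod_cast this
      linarith [e1.2, e2.2]
  · have e1 : (r + 1 : ℝ) * (w / r - r * h) - (r + 1) ^ 2 * (17 * r * h) =
        w + h * (100 * r ^ 3 - r ^ 2 - r - 17 * r * (r + 1) ^ 2) := by
      rw [hwr]
      have : w = 100 * (r : ℝ) ^ 3 * h * r := by rw [← hh]; ring
      rw [this]; ring
    change w < _
    rw [e1]
    have : (0 : ℝ) < 100 * r ^ 3 - r ^ 2 - r - 17 * r * (r + 1) ^ 2 := by
      nlinarith [mul_nonneg (sub_nonneg.2 hr0) (sub_nonneg.2 hr0),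
        mul_nonneg (mul_nonneg (sub_nonneg.2 hr0) (sub_nonneg.2 hr0)) (sub_nonneg.2 hr0)]
    nlinarith [mul_pos hh0 this]
  · rw [hwr]
    have : (r : ℝ) ≤ r ^ 3 := le_self_pow₀ hr0 (by norm_num)
    nlinarith [mul_le_mul_of_nonneg_right this hh0.le,
              mul_pos (by positivity : (0:ℝ) < r ^ 3) hh0]

end Structure

section Counting

variable {V : Type*} [Fintype V] [DecidableEq V]

lemma card_le_of_cover {α ι : Type*} (I : Finset ι) (F : Finset α) (P : ι → α → Prop) {N : ℝ}
    (hcov : ∀ a ∈ F, ∃ i ∈ I, P i a)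
    (hN : ∀ i ∈ I, ∀ F' ⊆ F, (∀ a ∈ F', P i a) → (F'.card : ℝ) ≤ N) :
    (F.card : ℝ) ≤ I.card * N := by
  have h1 : F ⊆ I.biUnion fun i => F.filter (P i) := fun a ha => by
    obtain ⟨i, hi, hP⟩ := hcov a ha
    exact Finset.mem_biUnion.2 ⟨i, hi, Finset.mem_filter.2 ⟨ha, hP⟩⟩
  calc (F.card : ℝ) ≤ ∑ i ∈ I, ((F.filter (P i)).card : ℝ) := by
        exact_mod_cast (Finset.card_le_card h1).trans Finset.card_biUnion_le
    _ ≤ ∑ i ∈ I, N := Finset.sum_le_sum fun i hi => hN i hi _ (Finset.filter_subset _ _)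
        fun a ha => (Finset.mem_filter.1 ha).2
    _ = I.card * N := by simp

lemma eq_of_isolate_eq {G G' : SimpleGraph V} {J : Finset V} (h : isolate G J = isolate G' J)
    (hrow : ∀ y ∈ J, nbr G y = nbr G' y) : G = G' := by
  have hr : ∀ y ∈ J, ∀ z, G.Adj y z ↔ G'.Adj y z := fun y hy z => by
    rw [← mem_nbr, hrow y hy, mem_nbr]
  ext a b
  by_cases ha : a ∈ J
  · exact hr a ha b
  by_cases hb : b ∈ J
  · rw [G.adj_comm, G'.adj_comm]; exact hr b hb a
  have : (isolate G J).Adj a b ↔ (isolate G' J).Adj a b := by rw [h]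
  simpa [isolate, ha, hb] using this

lemma card_le_two_pow_rows (F : Finset (SimpleGraph V)) (J : Finset V) (H : SimpleGraph V)
    (B : V → Finset V) (hH : ∀ G ∈ F, isolate G J = H) (hB : ∀ G ∈ F, ∀ y ∈ J, nbr G y ⊆ B y)
    {b : ℝ} (hb : ∀ y ∈ J, ((B y).card : ℝ) ≤ b) :
    (F.card : ℝ) ≤ (2 : ℝ) ^ (J.card * b) := by
  have h1 : F.card ≤ (Fintype.piFinset fun y : J => (B y).powerset).card := by
    refine Finset.card_le_card_of_injOn (fun G y => nbr G y) (fun G hG => ?_) ?_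
    · exact Fintype.mem_piFinset.2 fun y => Finset.mem_powerset.2 (hB G hG y y.2)
    · intro G hG G' hG' h
      exact eq_of_isolate_eq ((hH G hG).trans (hH G' hG').symm)
        fun y hy => congrFun h ⟨y, hy⟩
  have h2 : ((Fintype.piFinset fun y : J => (B y).powerset).card : ℝ) =
      ∏ y ∈ J, (2 : ℝ) ^ ((B y).card : ℝ) := by
    rw [Fintype.card_piFinset]
    push_cast
    simp only [Finset.card_powerset]
    rw [← Finset.prod_coe_sort J fun y => (2 : ℝ) ^ ((B y).card : ℝ)]
    simp
  calc (F.card : ℝ) ≤ ∏ y ∈ J, (2 : ℝ) ^ ((B y).card : ℝ) := by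
        rw [← h2]; exact_mod_cast h1
    _ ≤ ∏ y ∈ J, (2 : ℝ) ^ b := Finset.prod_le_prod (fun _ _ => by positivity)
        fun y hy => Real.rpow_le_rpow_of_exponent_le (by norm_num) (hb y hy)
    _ = (2 : ℝ) ^ (J.card * b) := by
        rw [Finset.prod_const, mul_comm, Real.rpow_mul (by norm_num), Real.rpow_natCast]

lemma card_pairs_inter_disjoint (E B D : Finset V) (hDE : D ⊆ E) (hDB : D ⊆ B) :
    (((E.powerset ×ˢ B.powerset).filter fun p => Disjoint (p.1 ∩ p.2) D).card : ℝ) =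
      2 ^ E.card * 2 ^ B.card * (3 / 4) ^ D.card := by
  have h1 : ((E.powerset ×ˢ B.powerset).filter fun p => Disjoint (p.1 ∩ p.2) D) =
      (E.powerset.sigma fun X => (B \ (X ∩ D)).powerset).map
        ⟨fun p : (_ : Finset V) × Finset V => (p.1, p.2), fun a b h => by
          cases a; cases b; simpa using h⟩ := by
    ext ⟨X, Y⟩
    simp only [Finset.mem_filter, Finset.mem_product, Finset.mem_powerset, Finset.mem_map,
      Finset.mem_sigma, Sigma.exists]
    constructor
    · rintro ⟨⟨hX, hY⟩, hd⟩
      refine ⟨X, Y, ⟨hX, fun z hz => Finset.mem_sdiff.2 ⟨hY hz, fun hzX => ?_⟩⟩, rfl⟩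
      rw [Finset.mem_inter] at hzX
      exact Finset.disjoint_left.1 hd (Finset.mem_inter.2 ⟨hzX.1, hz⟩) hzX.2
    · rintro ⟨X', Y', ⟨hX, hY⟩, h⟩
      obtain ⟨rfl, rfl⟩ := Prod.mk.inj h
      clear h
      refine ⟨⟨hX, hY.trans Finset.sdiff_subset⟩, Finset.disjoint_left.2 fun z hz hzD => ?_⟩
      rw [Finset.mem_inter] at hz
      exact (Finset.mem_sdiff.1 (hY hz.2)).2 (Finset.mem_inter.2 ⟨hz.1, hzD⟩)
  rw [h1, Finset.card_map, Finset.card_sigma]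
  push_cast
  simp only [Finset.card_powerset]
  have h2 : ∀ X : Finset V, ((2 ^ (B \ (X ∩ D)).card : ℕ) : ℝ) =
      2 ^ B.card * ∏ z ∈ X, if z ∈ D then (1 / 2 : ℝ) else 1 := by
    intro X
    rw [Finset.prod_ite, Finset.prod_const_one, mul_one, Finset.prod_const,
      Finset.filter_mem_eq_inter]
    have h3 : (B \ (X ∩ D)).card + (X ∩ D).card = B.card :=
      Finset.card_sdiff_add_card_eq_card (Finset.inter_subset_right.trans hDB)
    rw [← h3, pow_add]
    push_cast
    rw [mul_assoc, ← mul_pow]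
    norm_num
  rw [Finset.sum_congr rfl fun X _ => h2 X, ← Finset.mul_sum, ← Finset.prod_one_add]
  have h4 : ∏ z ∈ E, (1 + if z ∈ D then (1 / 2 : ℝ) else 1) = 2 ^ E.card * (3 / 4) ^ D.card := by
    rw [← Finset.prod_sdiff hDE, Finset.prod_congr rfl (g := fun _ => (2 : ℝ)) fun z hz => by
      rw [if_neg (Finset.mem_sdiff.1 hz).2]; norm_num,
      Finset.prod_congr rfl (s₁ := D) (g := fun _ => (3 / 2 : ℝ)) fun z hz => by
      rw [if_pos hz]; norm_num]
    rw [Finset.prod_const, Finset.prod_const, ← Finset.card_sdiff_add_card_eq_card hDE, pow_add,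
      mul_assoc, ← mul_pow]
    norm_num
  rw [h4]
  ring

lemma card_le_of_pair_rows {F : Finset (SimpleGraph V)} {H : SimpleGraph V} {x y : V}
    (E B D : Finset V) (hH : ∀ G ∈ F, isolate G {x, y} = H) (hE : ∀ G ∈ F, nbr G x ⊆ E)
    (hB : ∀ G ∈ F, nbr G y ⊆ B) (hD : ∀ G ∈ F, Disjoint (nbr G x ∩ nbr G y) D)
    (hDE : D ⊆ E) (hDB : D ⊆ B) :
    (F.card : ℝ) ≤ 2 ^ ((E.card : ℝ) + B.card + -(2 / 5) * (D.card : ℝ)) := by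
  have hinj : F.card ≤
      ((E.powerset ×ˢ B.powerset).filter fun p => Disjoint (p.1 ∩ p.2) D).card := by
    refine Finset.card_le_card_of_injOn (fun G => (nbr G x, nbr G y)) (fun G hG => ?_) ?_
    · exact Finset.mem_filter.2 ⟨Finset.mem_product.2 ⟨Finset.mem_powerset.2 (hE G hG),
        Finset.mem_powerset.2 (hB G hG)⟩, hD G hG⟩
    · intro G hG G' hG' h
      obtain ⟨hx, hy⟩ := Prod.mk.inj h
      refine eq_of_isolate_eq ((hH G hG).trans (hH G' hG').symm) fun z hz => ?_
      rcases Finset.mem_insert.1 hz with rfl | hz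
      · exact hx
      · rw [Finset.mem_singleton.1 hz]; exact hy
  have h34 : (3 / 4 : ℝ) ≤ 2 ^ (-(2 / 5) : ℝ) := by
    rw [← Real.rpow_le_rpow_iff (z := 5) (by norm_num) (by positivity) (by norm_num),
      ← Real.rpow_mul (by norm_num)]
    norm_num
  have hpow : (3 / 4 : ℝ) ^ D.card ≤ 2 ^ (-(2 / 5) * (D.card : ℝ)) := by
    rw [Real.rpow_mul (by norm_num), Real.rpow_natCast]
    gcongr
  calc (F.card : ℝ) ≤ 2 ^ E.card * 2 ^ B.card * (3 / 4) ^ D.card := by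
        rw [← card_pairs_inter_disjoint E B D hDE hDB]; exact_mod_cast hinj
    _ ≤ 2 ^ E.card * 2 ^ B.card * 2 ^ (-(2 / 5) * (D.card : ℝ)) := by gcongr
    _ = 2 ^ ((E.card : ℝ) + B.card + -(2 / 5) * (D.card : ℝ)) := by
        rw [Real.rpow_add (by norm_num), Real.rpow_add (by norm_num), Real.rpow_natCast,
          Real.rpow_natCast]

end Counting

section Recursion

variable {V : Type*} [Fintype V] [DecidableEq V]

lemma exists_isolate_cert {q f i : ℕ} {s J : Finset V} {G H : SimpleGraph V} {R : Finset V}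
    (hH : isolate G J = H) (hR : R ∈ certs q f s G J i) :
    ∃ R' ∈ certs q f s H J i, R' \ J = R \ J := hH ▸ exists_certs_isolate hR

lemma card_le_of_badRows {q f r : ℕ} {h σ : ℝ} {s Q : Finset V}
    (F T : Finset (SimpleGraph V)) (hmap : ∀ G ∈ F, isolate G Q ∈ T)
    (hσ : ∀ H ∈ T, ((certs q f s H Q r).card : ℝ) ≤ 2 ^ σ)
    (hbad : ∀ G ∈ F, BadRows q f r h s G Q) :
    (F.card : ℝ) ≤ T.card *
      2 ^ (s.card + σ * q + q * ((1 - 1 / (r : ℝ)) * s.card - h + q)) := by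
  rcases F.eq_empty_or_nonempty with rfl | ⟨G₀, hG₀⟩
  · simp; positivity
  have hQc : Q.card = q := (hbad G₀ hG₀).2.1
  refine card_le_of_cover T F (fun H G => isolate G Q = H) (fun G hG => ⟨_, hmap G hG, rfl⟩)
    fun H hH F₁ hF₁ hF₁H => ?_
  set b : ℝ := (1 - 1 / (r : ℝ)) * s.card - h + q with hb
  have hI : (((s.powerset ×ˢ Fintype.piFinset fun _ : Q => certs q f s H Q r).card : ℕ) : ℝ) ≤
      2 ^ (s.card + σ * q : ℝ) := by
    rw [Finset.card_product, Fintype.card_piFinset]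
    push_cast
    simp only [Finset.prod_const, Finset.card_univ, Fintype.card_coe, hQc, Finset.card_powerset]
    rw [Real.rpow_add (by norm_num), Real.rpow_mul (by norm_num), Real.rpow_natCast,
      Real.rpow_natCast]
    push_cast
    gcongr
    exact hσ H hH
  refine (card_le_of_cover (s.powerset ×ˢ Fintype.piFinset fun _ : Q => certs q f s H Q r) F₁
    (fun p G => ∀ y : Q, nbr G y ⊆ p.1 ∪ (s \ p.2 y) ∪ Q ∧
      ((p.1 ∪ (s \ p.2 y) ∪ Q).card : ℝ) ≤ b) ?_ (N := 2 ^ (q * b)) ?_).trans ?_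
  · intro G hG
    obtain ⟨-, -, ρ, hρ, R, hR, hrow⟩ := hbad G (hF₁ hG)
    have := fun y : Q => exists_isolate_cert (hF₁H G hG) (hρ y y.2)
    choose ρ' h1 h2 using this
    have h3 : ∀ y : Q, R ∪ (s \ ρ' y) ∪ Q = R ∪ (s \ ρ y) ∪ Q := fun y => by
      have h2 := h2 y
      ext z
      have := Finset.ext_iff.1 h2 z
      simp only [Finset.mem_sdiff, Finset.mem_union] at this ⊢
      tauto
    refine ⟨(R, ρ'), Finset.mem_product.2 ⟨Finset.mem_powerset.2 hR,
      Fintype.mem_piFinset.2 h1⟩, fun y => ?_⟩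
    simp only [h3]
    obtain ⟨h4, h5⟩ := hrow y y.2
    refine ⟨h4.trans Finset.subset_union_left, ?_⟩
    have h6 : ((R ∪ (s \ ρ y) ∪ Q).card : ℝ) ≤ (R ∪ (s \ ρ y)).card + Q.card := by
      exact_mod_cast Finset.card_union_le _ _
    rw [hQc] at h6
    linarith
  · intro p hp F₂ hF₂ hF₂p
    rcases F₂.eq_empty_or_nonempty with rfl | ⟨G₁, hG₁⟩
    · simp; positivity
    · have hb := hF₂p _ hG₁
      have := card_le_two_pow_rows F₂ Q H
        (fun y => if hy : y ∈ Q then p.1 ∪ (s \ p.2 ⟨y, hy⟩) ∪ Q else ∅)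
        (fun G hG => hF₁H G (hF₂ hG)) (b := b)
        (fun G hG y hy => by
          simpa only [hy, dite_true] using (hF₂p G hG ⟨y, hy⟩).1)
        (fun y hy => by
          simpa only [hy, dite_true] using (hb ⟨y, hy⟩).2)
      rwa [hQc] at this
  · rw [Real.rpow_add (by norm_num) (s.card + σ * q : ℝ)]
    gcongr

lemma card_le_of_badVertex {q f r : ℕ} {h σ : ℝ} {s : Finset V} {x : V}
    (F T : Finset (SimpleGraph V)) (hF : ∀ G ∈ F, LivesOn s G)
    (hmap : ∀ G ∈ F, isolate G {x} ∈ T)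
    (hσ : ∀ H ∈ T, ((certs q f s H {x} r).card : ℝ) ≤ 2 ^ σ)
    (hbad : ∀ G ∈ F, BadVertex q f r h s G x) :
    (F.card : ℝ) ≤ T.card * 2 ^ (2 * σ + (s.card - (s.card : ℝ) / r - r * h + 1)) := by
  refine card_le_of_cover T F (fun H G => isolate G {x} = H) (fun G hG => ⟨_, hmap G hG, rfl⟩)
    fun H hH F₁ hF₁ hF₁H => ?_
  set b : ℝ := s.card - (s.card : ℝ) / r - r * h + 1 with hb
  refine (card_le_of_cover (certs q f s H {x} r ×ˢ certs q f s H {x} r) F₁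
    (fun p G => nbr G x ⊆ s \ (p.1 ∪ p.2) ∪ {x} ∧
      ((s \ (p.1 ∪ p.2) ∪ {x}).card : ℝ) ≤ b) ?_ (N := 2 ^ b) ?_).trans ?_
  · intro G hG
    obtain ⟨-, R₁, hR₁, R₂, hR₂, hd, hc⟩ := hbad G (hF₁ hG)
    have hs := certs_subset (hF G (hF₁ hG)) hR₁
    have hs' := certs_subset (hF G (hF₁ hG)) hR₂
    obtain ⟨R₁', h1, h1'⟩ := exists_isolate_cert (hF₁H G hG) hR₁
    obtain ⟨R₂', h2, h2'⟩ := exists_isolate_cert (hF₁H G hG) hR₂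
    have h3 : s \ (R₁' ∪ R₂') ∪ {x} = s \ (R₁ ∪ R₂) ∪ {x} := by
      ext z
      have e1 := Finset.ext_iff.1 h1' z
      have e2 := Finset.ext_iff.1 h2' z
      simp only [Finset.mem_sdiff, Finset.mem_union] at e1 e2 ⊢
      tauto
    refine ⟨(R₁', R₂'), Finset.mem_product.2 ⟨h1, h2⟩, ?_⟩
    simp only [h3]
    constructor
    · intro z hz
      exact Finset.mem_union_left _ (Finset.mem_sdiff.2 ⟨(hF G (hF₁ hG)).nbr_subset x hz,
        Finset.disjoint_left.1 hd hz⟩)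
    · have e1 : ((s \ (R₁ ∪ R₂) ∪ {x}).card : ℝ) ≤ (s \ (R₁ ∪ R₂)).card + 1 := by
        exact_mod_cast (Finset.card_union_le _ _).trans_eq (by simp)
      have e2 : ((s \ (R₁ ∪ R₂)).card : ℝ) + (R₁ ∪ R₂).card = s.card := by
        exact_mod_cast Finset.card_sdiff_add_card_eq_card (Finset.union_subset hs hs')
      rw [hb]
      linarith
  · intro p hp F₂ hF₂ hF₂p
    rcases F₂.eq_empty_or_nonempty with rfl | ⟨G₁, hG₁⟩
    · simp; positivity
    · have := card_le_two_pow_rows F₂ {x} H (fun _ => s \ (p.1 ∪ p.2) ∪ {x})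
        (fun G hG => hF₁H G (hF₂ hG)) (b := b)
        (fun G hG y hy => by
          rw [Finset.mem_singleton.1 hy]; exact (hF₂p G hG).1)
        (fun y hy => (hF₂p _ hG₁).2)
      simpa using this
  · rw [Real.rpow_add (by norm_num) (2 * σ), Finset.card_product, two_mul,
      Real.rpow_add (by norm_num) σ]
    push_cast
    have := hσ H hH
    gcongr

lemma card_le_of_badPair {q f r : ℕ} {h σ : ℝ} {s : Finset V} {x y : V}
    (F T : Finset (SimpleGraph V)) (hF : ∀ G ∈ F, LivesOn s G)
    (hmap : ∀ G ∈ F, isolate G {x, y} ∈ T)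
    (hσ : ∀ H ∈ T, ((certs q f s H {x, y} r).card : ℝ) ≤ 2 ^ σ)
    (hbad : ∀ G ∈ F, BadPair q f r h s G x y) :
    (F.card : ℝ) ≤ T.card *
      2 ^ (3 * σ + (2 * s.card - 2 * ((s.card : ℝ) / r) - 2 * r * h + 5)) := by
  have hJ : (({x, y} : Finset V).card : ℝ) ≤ 2 := by exact_mod_cast Finset.card_le_two
  refine card_le_of_cover T F (fun H G => isolate G {x, y} = H)
    (fun G hG => ⟨_, hmap G hG, rfl⟩) fun H hH F₁ hF₁ hF₁H => ?_
  obtain ⟨b, hb⟩ : ∃ b : ℝ, b = 2 * s.card - 2 * ((s.card : ℝ) / r) - 2 * r * h + 5 := ⟨_, rfl⟩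
  obtain ⟨J, hJdef⟩ : ∃ J : Finset V, J = {x, y} := ⟨_, rfl⟩
  obtain ⟨w, hw⟩ : ∃ w : ℝ, w = (s.card : ℝ) / r - r * h := ⟨_, rfl⟩
  rw [← hb]
  refine (card_le_of_cover (certs q f s H {x, y} r ×ˢ certs q f s H {x, y} r ×ˢ
    certs q f s H {x, y} r) F₁ (fun p G =>
    nbr G x ⊆ s \ p.1 ∪ J ∧ nbr G y ⊆ s \ p.2.1 ∪ J ∧
      Disjoint (nbr G x ∩ nbr G y) ((p.2.2 \ (p.1 ∪ p.2.1)) \ J) ∧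
      ((p.2.2 \ (p.1 ∪ p.2.1)) \ J) ⊆ s ∧
      ((s \ p.1 ∪ J).card : ℝ) ≤ s.card - w + 2 ∧
      ((s \ p.2.1 ∪ J).card : ℝ) ≤ s.card - w + 2 ∧
      10 * r * h - 2 ≤ ((p.2.2 \ (p.1 ∪ p.2.1)) \ J).card) ?_ (N := 2 ^ b) ?_).trans ?_
  · intro G hG
    obtain ⟨-, -, -, A, hA, B, hB, D, hD, hdA, hdB, hdD, hcA, hcB, hcD⟩ := hbad G (hF₁ hG)
    have hGs := hF G (hF₁ hG)
    have hAs := certs_subset hGs hA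
    have hBs := certs_subset hGs hB
    have hDs := certs_subset hGs hD
    obtain ⟨A', h1, h1'⟩ := exists_isolate_cert (hF₁H G hG) hA
    obtain ⟨B', h2, h2'⟩ := exists_isolate_cert (hF₁H G hG) hB
    obtain ⟨D', h3, h3'⟩ := exists_isolate_cert (hF₁H G hG) hD
    rw [← hJdef] at h1' h2' h3' hJ
    rw [← hw] at hcA hcB
    have e1 : s \ A' ∪ J = s \ A ∪ J := by
      ext z
      have e1 := Finset.ext_iff.1 h1' z
      simp only [Finset.mem_sdiff, Finset.mem_union] at e1 ⊢
      tauto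
    have e2 : s \ B' ∪ J = s \ B ∪ J := by
      ext z
      have e1 := Finset.ext_iff.1 h2' z
      simp only [Finset.mem_sdiff, Finset.mem_union] at e1 ⊢
      tauto
    have e3 : (D' \ (A' ∪ B')) \ J = (D \ (A ∪ B)) \ J := by
      ext z
      have e1 := Finset.ext_iff.1 h1' z
      have e2 := Finset.ext_iff.1 h2' z
      have e3 := Finset.ext_iff.1 h3' z
      by_cases hz : z ∈ J
      · simp [hz]
      · simp only [Finset.mem_sdiff, hz, not_false_eq_true, and_true] at e1 e2 e3
        simp [hz, e1, e2, e3]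
    have hrow : ∀ (z : V) (R : Finset V), Disjoint (nbr G z) R → nbr G z ⊆ s \ R ∪ J :=
      fun z R hd v hv => Finset.mem_union_left _ (Finset.mem_sdiff.2
        ⟨hGs.nbr_subset z hv, Finset.disjoint_left.1 hd hv⟩)
    have hcard : ∀ R ⊆ s, w ≤ R.card → ((s \ R ∪ J).card : ℝ) ≤ s.card - w + 2 := by
      intro R hR hc
      have e1 : ((s \ R ∪ J).card : ℝ) ≤ (s \ R).card + J.card := by
        exact_mod_cast Finset.card_union_le _ _
      have e2 : ((s \ R).card : ℝ) + R.card = s.card := by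
        exact_mod_cast Finset.card_sdiff_add_card_eq_card hR
      linarith
    refine ⟨(A', B', D'), Finset.mem_product.2 ⟨h1, Finset.mem_product.2 ⟨h2, h3⟩⟩, ?_⟩
    simp only [e1, e2, e3]
    refine ⟨hrow x A hdA, hrow y B hdB, hdD.mono_right
      (Finset.sdiff_subset.trans Finset.sdiff_subset),
      Finset.sdiff_subset.trans (Finset.sdiff_subset.trans hDs),
      hcard A hAs hcA, hcard B hBs hcB, ?_⟩
    have e4 : (D \ (A ∪ B)).card ≤ ((D \ (A ∪ B)) \ J).card + J.card := by
      rw [Finset.card_sdiff_add_card]; exact Finset.card_le_card Finset.subset_union_left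
    have e4' : ((D \ (A ∪ B)).card : ℝ) ≤ ((D \ (A ∪ B)) \ J).card + J.card := by
      exact_mod_cast e4
    linarith
  · intro p hp F₂ hF₂ hF₂p
    rcases F₂.eq_empty_or_nonempty with rfl | ⟨G₁, hG₁⟩
    · simp; positivity
    obtain ⟨-, -, -, hDs, hE, hB, hD⟩ := hF₂p G₁ hG₁
    refine (card_le_of_pair_rows (s \ p.1 ∪ J) (s \ p.2.1 ∪ J) ((p.2.2 \ (p.1 ∪ p.2.1)) \ J)
      (fun G hG => hF₁H G (hF₂ hG)) (fun G hG => (hF₂p G hG).1) (fun G hG => (hF₂p G hG).2.1)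
      (fun G hG => (hF₂p G hG).2.2.1) (fun z hz => ?_) (fun z hz => ?_)).trans ?_
    · have hzs := hDs hz
      simp only [Finset.mem_sdiff, Finset.mem_union] at hz ⊢
      tauto
    · have hzs := hDs hz
      simp only [Finset.mem_sdiff, Finset.mem_union] at hz ⊢
      tauto
    · refine Real.rpow_le_rpow_of_exponent_le (by norm_num) ?_
      rw [hw] at hE hB
      rw [hb]
      linarith
  · have e1 : (2 : ℝ) ^ (3 * σ) = 2 ^ σ * (2 ^ σ * 2 ^ σ) := by
      rw [← Real.rpow_add (by norm_num), ← Real.rpow_add (by norm_num)]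
      ring_nf
    rw [Real.rpow_add (by norm_num) (3 * σ), e1, Finset.card_product, Finset.card_product]
    push_cast
    have := hσ H hH
    gcongr

end Recursion

section Recursion

variable {V : Type*} [Fintype V] [DecidableEq V]

/-- The `K_{r+1}`-free graphs on `s` that do not become `r`-partite after isolating fewer than
about `l * q` vertices. -/
noncomputable def stubborn (q r l : ℕ) (s : Finset V) : Finset (SimpleGraph V) :=
  Finset.univ.filter fun G => LivesOn s G ∧ G.CliqueFree (r + 1) ∧
    ∀ J : Finset V, J.card + q ≤ l * q → ¬ ∃ c : V → Fin r, IsProper (isolate G J) c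

/-- The exponent `(1 - 1 / r) * w ^ 2 / 2`. -/
noncomputable def turanExp (r : ℕ) (w : ℝ) : ℝ := (1 - 1 / (r : ℝ)) * w ^ 2 / 2

lemma isolate_mem_stubborn {q r l : ℕ} {s J : Finset V} {G : SimpleGraph V}
    (hG : G ∈ stubborn q r (l + 1) s) (hJ : J.card ≤ q) :
    isolate G J ∈ stubborn q r l (s \ J) := by
  obtain ⟨-, h1, h2, h3⟩ := Finset.mem_filter.1 hG
  refine Finset.mem_filter.2 ⟨Finset.mem_univ _, h1.isolate J, h2.anti (isolate_le G J),
    fun J' hJ' => ?_⟩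
  rw [isolate_isolate]
  refine h3 _ ?_
  have := Finset.card_union_le J J'
  rw [add_mul, one_mul]
  omega

lemma bad_of_mem_stubborn_succ {q f r l : ℕ} {h : ℝ} {s : Finset V} {G : SimpleGraph V}
    (hr : 1 ≤ r) (hq : 1 ≤ q) (hf : f = 2 * q * r) (hfh : (f : ℝ) ≤ h)
    (hh : 100 * (r : ℝ) ^ 4 * h = s.card) (hG : G ∈ stubborn q r (l + 1) s) :
    (∃ Q, BadRows q f r h s G Q) ∨ (∃ x, BadVertex q f r h s G x) ∨
      ∃ x y, BadPair q f r h s G x y := by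
  obtain ⟨-, h1, h2, h3⟩ := Finset.mem_filter.1 hG
  by_contra! hno
  refine h3 ∅ (by simp; nlinarith) ?_
  rw [isolate_empty]
  exact exists_proper_of_not_bad h1 h2 hr hq hf hfh hh hno.1 hno.2.1 hno.2.2

lemma card_stubborn_succ_le {q f r l : ℕ} {h σ lg Λ : ℝ} {s : Finset V} (hr : 1 ≤ r)
    (hq : q = 1000 * r ^ 4) (hf : f = 2 * q * r) (hfh : (f : ℝ) ≤ h)
    (hh : 100 * (r : ℝ) ^ 4 * h = s.card)
    (hσ : ∀ H S, ((certs q f s H S r).card : ℝ) ≤ 2 ^ σ) (hσ0 : 0 ≤ σ) (hlg0 : 0 ≤ lg)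
    (hlg : (s.card : ℝ) ≤ 2 ^ lg) (h1 : 3 * σ + 2 * lg + 9 ≤ h / 2)
    (h2 : 2 * (q : ℝ) ^ 2 + q * (σ + lg) ≤ s.card)
    (ih : ∀ J ⊆ s, J.Nonempty → J.card ≤ q →
      ((stubborn q r l (s \ J)).card : ℝ) ≤ 2 ^ (turanExp r (s.card - J.card) + Λ)) :
    ((stubborn q r (l + 1) s).card : ℝ) ≤ 2 ^ (turanExp r s.card + Λ - h / 2) := by
  have hr1 : (1 : ℝ) ≤ r := by exact_mod_cast hr
  have hr4 : (1 : ℝ) ≤ (r : ℝ) ^ 4 := one_le_pow₀ hr1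
  have hqr : (q : ℝ) = 1000 * (r : ℝ) ^ 4 := by rw [hq]; push_cast; ring
  have hq2 : 2 ≤ q := by
    have := Nat.one_le_pow 4 r hr
    omega
  obtain ⟨w, hw⟩ : ∃ w : ℝ, w = s.card := ⟨_, rfl⟩
  obtain ⟨a, ha⟩ : ∃ a : ℝ, a = 1 / (r : ℝ) := ⟨_, rfl⟩
  have ha0 : 0 ≤ a := by rw [ha]; positivity
  have hwr : (s.card : ℝ) / r = a * w := by rw [ha, hw]; ring
  have hw0 : 0 ≤ w := by rw [hw]; positivity
  rw [← hw] at hlg h2 ih ⊢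
  set F := stubborn q r (l + 1) s with hFdef
  have hF : ∀ G ∈ F, LivesOn s G := fun G hG => (Finset.mem_filter.1 hG).2.1
  have hstep : ∀ (J : Finset V) (e : ℝ), J ⊆ s → J.Nonempty → J.card ≤ q →
      e ≤ turanExp r w - turanExp r (w - J.card) - h / 2 - 2 →
      ((stubborn q r l (s \ J)).card : ℝ) * 2 ^ e ≤ 2 ^ (turanExp r w + Λ - h / 2 - 2) := by
    intro J e hJs hJ hJc he
    calc ((stubborn q r l (s \ J)).card : ℝ) * 2 ^ e
        ≤ 2 ^ (turanExp r (w - J.card) + Λ) * 2 ^ e := by gcongr; exact ih J hJs hJ hJc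
      _ = 2 ^ (turanExp r (w - J.card) + Λ + e) := (Real.rpow_add (by norm_num) _ _).symm
      _ ≤ _ := Real.rpow_le_rpow_of_exponent_le (by norm_num) (by linarith)
  have hB : ((F.filter fun G => ∃ Q, BadRows q f r h s G Q).card : ℝ) ≤
      2 ^ (turanExp r w + Λ - h / 2 - 2) := by
    have hI : ((Finset.powersetCard q s).card : ℝ) ≤ 2 ^ (lg * q) := by
      rw [Finset.card_powersetCard, Real.rpow_mul (by norm_num), Real.rpow_natCast]
      calc ((s.card.choose q : ℕ) : ℝ) ≤ (s.card : ℝ) ^ q := by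
            exact_mod_cast Nat.choose_le_pow _ _
        _ ≤ _ := by rw [← hw]; gcongr
    refine (card_le_of_cover (Finset.powersetCard q s) _
      (fun Q G => BadRows q f r h s G Q) ?_
      (N := 2 ^ (turanExp r w + Λ - h / 2 - 2 - lg * q)) ?_).trans ?_
    · intro G hG
      obtain ⟨Q, hQ⟩ := (Finset.mem_filter.1 hG).2
      exact ⟨Q, Finset.mem_powersetCard.2 ⟨hQ.1, hQ.2.1⟩, hQ⟩
    · intro Q hQ F' hF' hbad
      obtain ⟨hQs, hQc⟩ := Finset.mem_powersetCard.1 hQ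
      have := card_le_of_badRows F' (stubborn q r l (s \ Q)) (fun G hG =>
        isolate_mem_stubborn (Finset.filter_subset _ _ (hF' hG)) hQc.le)
        (fun H _ => hσ H Q) hbad
      refine this.trans ?_
      rw [← hw, ← ha]
      have h3 := hstep Q (w + σ * q + q * ((1 - a) * w - h + q) + lg * q) hQs
        (Finset.card_pos.1 (by omega)) hQc.le (by
          rw [hQc]
          simp only [turanExp, ← ha]
          have e1 : q * h = 10 * w := by rw [hqr, hw, ← hh]; ring
          have e2 : h ≤ w := by
            rw [hw, ← hh]
            have : (f : ℝ) ≥ 0 := by positivity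
            nlinarith
          have e3 : (0 : ℝ) ≤ a * (q : ℝ) ^ 2 := by positivity
          have e4 : (2 : ℝ) ≤ q := by exact_mod_cast hq2
          nlinarith)
      rw [Real.rpow_add (by norm_num), ← mul_assoc] at h3
      rw [Real.rpow_sub (by norm_num) _ (lg * q), le_div_iff₀ (by positivity)]
      exact h3
    · calc _ ≤ (2 : ℝ) ^ (lg * q) * 2 ^ (turanExp r w + Λ - h / 2 - 2 - lg * q) := by gcongr
        _ = _ := by rw [← Real.rpow_add (by norm_num)]; ring_nf
  have hD : ((F.filter fun G => ∃ x, BadVertex q f r h s G x).card : ℝ) ≤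
      2 ^ (turanExp r w + Λ - h / 2 - 2) := by
    refine (card_le_of_cover s _ (fun x G => BadVertex q f r h s G x) ?_
      (N := 2 ^ (turanExp r w + Λ - h / 2 - 2 - lg)) ?_).trans ?_
    · intro G hG
      obtain ⟨x, hx⟩ := (Finset.mem_filter.1 hG).2
      exact ⟨x, hx.1, hx⟩
    · intro x hx F' hF' hbad
      have := card_le_of_badVertex F' (stubborn q r l (s \ {x}))
        (fun G hG => hF G (Finset.filter_subset _ _ (hF' hG))) (fun G hG =>
        isolate_mem_stubborn (Finset.filter_subset _ _ (hF' hG)) (by simp; omega))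
        (fun H _ => hσ H {x}) hbad
      refine this.trans ?_
      rw [hwr, ← hw]
      have h3 := hstep {x} (2 * σ + (w - a * w - r * h + 1) + lg)
        (Finset.singleton_subset_iff.2 hx) (Finset.singleton_nonempty x) (by simp; omega) (by
          simp only [turanExp, ← ha, Finset.card_singleton, Nat.cast_one]
          have : h ≤ r * h := by
            have : (f : ℝ) ≥ 0 := by positivity
            nlinarith
          nlinarith)
      rw [Real.rpow_add (by norm_num) _ lg, ← mul_assoc] at h3
      rw [Real.rpow_sub (by norm_num) _ lg, le_div_iff₀ (by positivity)]
      exact h3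
    · rw [← hw]
      calc _ ≤ (2 : ℝ) ^ lg * 2 ^ (turanExp r w + Λ - h / 2 - 2 - lg) := by gcongr
        _ = _ := by rw [← Real.rpow_add (by norm_num)]; ring_nf
  have hC : ((F.filter fun G => ∃ x y, BadPair q f r h s G x y).card : ℝ) ≤
      2 ^ (turanExp r w + Λ - h / 2 - 2) := by
    refine (card_le_of_cover (s ×ˢ s) _ (fun p G => BadPair q f r h s G p.1 p.2) ?_
      (N := 2 ^ (turanExp r w + Λ - h / 2 - 2 - 2 * lg)) ?_).trans ?_
    · intro G hG
      obtain ⟨x, y, hx⟩ := (Finset.mem_filter.1 hG).2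
      exact ⟨(x, y), Finset.mem_product.2 ⟨hx.1, hx.2.1⟩, hx⟩
    · rintro ⟨x, y⟩ hx F' hF' hbad
      rcases F'.eq_empty_or_nonempty with rfl | ⟨G₀, hG₀⟩
      · simp; positivity
      obtain ⟨hxs, hys, hxy, -⟩ := hbad G₀ hG₀
      have hJ := Finset.card_pair hxy
      simp only at hxs hys hxy hJ
      have := card_le_of_badPair F' (stubborn q r l (s \ {x, y}))
        (fun G hG => hF G (Finset.filter_subset _ _ (hF' hG))) (fun G hG =>
        isolate_mem_stubborn (Finset.filter_subset _ _ (hF' hG)) (by omega))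
        (fun H _ => hσ H {x, y}) hbad
      refine this.trans ?_
      rw [hwr, ← hw]
      have h3 := hstep {x, y} (3 * σ + (2 * w - 2 * (a * w) - 2 * r * h + 5) + 2 * lg)
        (Finset.insert_subset hxs (Finset.singleton_subset_iff.2 hys))
        (Finset.insert_nonempty _ _) (by omega) (by
          rw [hJ]
          simp only [turanExp, ← ha]
          have : h ≤ r * h := by
            have : (f : ℝ) ≥ 0 := by positivity
            nlinarith
          push_cast
          nlinarith)
      rw [Real.rpow_add (by norm_num) _ (2 * lg), ← mul_assoc] at h3
      rw [Real.rpow_sub (by norm_num) _ (2 * lg), le_div_iff₀ (by positivity)]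
      exact h3
    · rw [Finset.card_product]
      push_cast
      rw [← hw]
      calc _ ≤ ((2 : ℝ) ^ lg * 2 ^ lg) * 2 ^ (turanExp r w + Λ - h / 2 - 2 - 2 * lg) := by
            gcongr
        _ = _ := by rw [← Real.rpow_add (by norm_num), ← Real.rpow_add (by norm_num)]; ring_nf
  have hcov : F.card ≤ (F.filter fun G => ∃ Q, BadRows q f r h s G Q).card +
      (F.filter fun G => ∃ x, BadVertex q f r h s G x).card +
      (F.filter fun G => ∃ x y, BadPair q f r h s G x y).card := by
    refine le_trans (Finset.card_le_card fun G hG => ?_) ((Finset.card_union_le _ _).trans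
      (Nat.add_le_add_right (Finset.card_union_le _ _) _))
    simp only [Finset.mem_union, Finset.mem_filter, hG, true_and]
    have := bad_of_mem_stubborn_succ hr (by omega) hf hfh hh hG
    tauto
  have hcov' : (F.card : ℝ) ≤ (F.filter fun G => ∃ Q, BadRows q f r h s G Q).card +
      (F.filter fun G => ∃ x, BadVertex q f r h s G x).card +
      (F.filter fun G => ∃ x y, BadPair q f r h s G x y).card := by exact_mod_cast hcov
  have hfin : (2 : ℝ) ^ (turanExp r w + Λ - h / 2) =
      4 * 2 ^ (turanExp r w + Λ - h / 2 - 2) := by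
    rw [Real.rpow_sub (by norm_num) _ 2]
    norm_num
    ring
  have : (0 : ℝ) < 2 ^ (turanExp r w + Λ - h / 2 - 2) := by positivity
  rw [hfin]
  linarith

end Recursion

section Totals

variable {V : Type*} [Fintype V] [DecidableEq V]

/-- The complete multipartite graph on `s` whose parts are the colour classes of `c`. -/
def multipartiteOn {r : ℕ} (s : Finset V) (c : V → Fin r) : SimpleGraph V where
  Adj a b := a ∈ s ∧ b ∈ s ∧ c a ≠ c b
  symm := ⟨fun _ _ h => ⟨h.2.1, h.1, h.2.2.symm⟩⟩
  loopless := ⟨fun _ h => h.2.2 rfl⟩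

lemma LivesOn.le_multipartiteOn {r : ℕ} {s : Finset V} {c : V → Fin r} {G : SimpleGraph V}
    (hG : LivesOn s G) (hc : IsProper G c) : G ≤ multipartiteOn s c :=
  fun a b h => ⟨hG a b h, hG b a h.symm, hc a b h⟩

lemma card_edgeFinset_multipartiteOn_le {r : ℕ} (hr : 1 ≤ r) (s : Finset V) (c : V → Fin r) :
    ((multipartiteOn s c).edgeFinset.card : ℝ) ≤ turanExp r s.card := by
  have h1 := (multipartiteOn s c).two_mul_card_edgeFinset
  have h2 : (Finset.univ.filter fun p : V × V => (multipartiteOn s c).Adj p.1 p.2).card +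
      ((s ×ˢ s).filter fun p => c p.1 = c p.2).card = s.card ^ 2 := by
    rw [sq, ← Finset.card_product, ← Finset.card_filter_add_card_filter_not (s := s ×ˢ s)
      (fun p => c p.1 ≠ c p.2)]
    congr 1
    · congr 1
      ext p
      rw [Finset.mem_filter_univ, Finset.mem_filter, Finset.mem_product, and_assoc]
      rfl
    · simp
  have h3 : ((s ×ˢ s).filter fun p => c p.1 = c p.2).card =
      ∑ i : Fin r, (s.filter fun v => c v = i).card ^ 2 := by
    rw [Finset.card_eq_sum_card_fiberwise (f := fun p : V × V => c p.1) (t := Finset.univ)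
      (fun _ _ => Finset.mem_coe.2 (Finset.mem_univ _))]
    refine Finset.sum_congr rfl fun i _ => ?_
    rw [sq, ← Finset.card_product]
    congr 1
    ext p
    simp only [Finset.mem_filter, Finset.mem_product]
    constructor
    · rintro ⟨⟨⟨h1, h2⟩, h3⟩, h4⟩
      exact ⟨⟨h1, h4⟩, h2, h3 ▸ h4⟩
    · rintro ⟨⟨h1, h4⟩, h2, h3⟩
      exact ⟨⟨⟨h1, h2⟩, h4.trans h3.symm⟩, h4⟩
  have h4 : s.card = ∑ i : Fin r, (s.filter fun v => c v = i).card :=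
    Finset.card_eq_sum_card_fiberwise fun _ _ => Finset.mem_coe.2 (Finset.mem_univ _)
  have h5 := sq_sum_le_card_mul_sum_sq (s := (Finset.univ : Finset (Fin r)))
    (f := fun i => ((s.filter fun v => c v = i).card : ℝ))
  have h6 : (s.card : ℝ) ^ 2 ≤ r * (((s ×ˢ s).filter fun p => c p.1 = c p.2).card : ℝ) := by
    rw [h3]
    rw [h4]
    push_cast
    simpa using h5
  have h7 : (2 : ℝ) * ((multipartiteOn s c).edgeFinset.card : ℝ) +
      (((s ×ˢ s).filter fun p => c p.1 = c p.2).card : ℝ) = s.card ^ 2 := by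
    exact_mod_cast h1 ▸ h2
  have hr0 : (0 : ℝ) < r := by exact_mod_cast hr
  have h8 : (s.card : ℝ) ^ 2 / r ≤ (((s ×ˢ s).filter fun p => c p.1 = c p.2).card : ℝ) := by
    rw [div_le_iff₀ hr0]
    linarith
  have h9 : turanExp r s.card = ((s.card : ℝ) ^ 2 - (s.card : ℝ) ^ 2 / r) / 2 := by
    unfold turanExp
    ring
  rw [h9]
  linarith

lemma card_le_two_pow_edges (F : Finset (SimpleGraph V)) (K : SimpleGraph V)
    (hF : ∀ G ∈ F, G ≤ K) : F.card ≤ 2 ^ K.edgeFinset.card := by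
  rw [← Finset.card_powerset]
  refine Finset.card_le_card_of_injOn (fun G => G.edgeFinset) (fun G hG => ?_) ?_
  · exact Finset.mem_powerset.2 (SimpleGraph.edgeFinset_mono (hF G hG))
  · intro G _ G' _ h
    exact SimpleGraph.edgeFinset_inj.1 h

/-- The extension by the colour `0` of a colouring of `s`. -/
def extendColoring {r : ℕ} (hr : 1 ≤ r) (s : Finset V) (c : s → Fin r) (v : V) : Fin r :=
  if hv : v ∈ s then c ⟨v, hv⟩ else ⟨0, hr⟩

lemma IsProper.extendColoring {r : ℕ} (hr : 1 ≤ r) {s : Finset V} {G : SimpleGraph V}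
    {c : V → Fin r} (hG : LivesOn s G) (hc : IsProper G c) :
    IsProper G (extendColoring hr s fun v => c v) := by
  intro a b h
  have ha := hG a b h
  have hb := hG b a h.symm
  simpa [_root_.extendColoring, ha, hb] using hc a b h

lemma card_le_of_proper {r : ℕ} (hr : 1 ≤ r) {s : Finset V} {lg : ℝ} (hlg : (r : ℝ) ≤ 2 ^ lg)
    (F : Finset (SimpleGraph V))
    (hF : ∀ G ∈ F, LivesOn s G ∧ ∃ c : V → Fin r, IsProper G c) :
    (F.card : ℝ) ≤ 2 ^ (turanExp r s.card + s.card * lg) := by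
  refine (card_le_of_cover (Finset.univ : Finset (s → Fin r)) F
    (fun c G => IsProper G (extendColoring hr s c)) (fun G hG => ?_)
    (N := 2 ^ turanExp r s.card) fun c _ F' hF' hc => ?_).trans ?_
  · obtain ⟨h1, c, hc⟩ := hF G hG
    exact ⟨_, Finset.mem_univ _, hc.extendColoring hr h1⟩
  · have := card_le_two_pow_edges F' (multipartiteOn s (extendColoring hr s c))
      fun G hG => (hF G (hF' hG)).1.le_multipartiteOn (hc G hG)
    calc (F'.card : ℝ) ≤ 2 ^ (multipartiteOn s (extendColoring hr s c)).edgeFinset.card := by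
          exact_mod_cast this
      _ = (2 : ℝ) ^ ((multipartiteOn s (extendColoring hr s c)).edgeFinset.card : ℝ) :=
          (Real.rpow_natCast _ _).symm
      _ ≤ _ := Real.rpow_le_rpow_of_exponent_le (by norm_num)
          (card_edgeFinset_multipartiteOn_le hr _ _)
  · have : ((Finset.univ : Finset (s → Fin r)).card : ℝ) ≤ 2 ^ (s.card * lg) := by
      rw [mul_comm, Real.rpow_mul (by norm_num), Real.rpow_natCast]
      simp only [Finset.card_univ, Fintype.card_fun, Fintype.card_coe, Fintype.card_fin]
      push_cast
      gcongr
    rw [add_comm, Real.rpow_add (by norm_num)]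
    gcongr

/-- The numerical constraints under which the recursive counting of `K_{r+1}`-free graphs on at
most `u` vertices applies to vertex sets of size at least `w₀`. -/
structure Admissible (q f r u : ℕ) (σ lg w₀ : ℝ) : Prop where
  hr : 1 ≤ r
  hq : q = 1000 * r ^ 4
  hf : f = 2 * q * r
  hlg : (u : ℝ) + 1 ≤ 2 ^ lg
  hrlg : (r : ℝ) ≤ 2 ^ lg
  hσ : ((3 * q) ^ r * f : ℝ) * lg ≤ σ
  h1 : 100 * (r : ℝ) ^ 4 * f ≤ w₀
  h2 : 200 * (r : ℝ) ^ 4 * (3 * σ + 2 * lg + 9) ≤ w₀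
  h3 : 2 * (q : ℝ) ^ 2 + q * (σ + lg) ≤ w₀

lemma Admissible.lg_nonneg {q f r u : ℕ} {σ lg w₀ : ℝ} (H : Admissible q f r u σ lg w₀) :
    0 ≤ lg := by
  by_contra hlt
  push Not at hlt
  have h1 := H.hlg
  have h2 : (2 : ℝ) ^ lg < 1 := Real.rpow_lt_one_of_one_lt_of_neg (by norm_num) hlt
  have h3 : (0 : ℝ) ≤ u := by positivity
  linarith

lemma Admissible.sigma_nonneg {q f r u : ℕ} {σ lg w₀ : ℝ} (H : Admissible q f r u σ lg w₀) :
    0 ≤ σ := le_trans (mul_nonneg (by positivity) H.lg_nonneg) H.hσ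

lemma Admissible.q_pos {q f r u : ℕ} {σ lg w₀ : ℝ} (H : Admissible q f r u σ lg w₀) :
    1 ≤ q := by
  have := Nat.one_le_pow 4 r H.hr
  have := H.hq
  omega

lemma Admissible.w_pos {q f r u : ℕ} {σ lg w₀ : ℝ} (H : Admissible q f r u σ lg w₀) :
    0 < w₀ := by
  have h1 : (1 : ℝ) ≤ q := by exact_mod_cast H.q_pos
  have h2 := H.h3
  have h3 : 0 ≤ (q : ℝ) * (σ + lg) := by
    have := H.lg_nonneg
    have := H.sigma_nonneg
    positivity
  nlinarith

lemma Admissible.card_stubborn_succ_le {q f r u l : ℕ} {σ lg w₀ Λ : ℝ}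
    (H : Admissible q f r u σ lg w₀) {s : Finset V} (hu : s.card ≤ u) (hw : w₀ ≤ s.card)
    (ih : ∀ J ⊆ s, J.Nonempty → J.card ≤ q →
      ((stubborn q r l (s \ J)).card : ℝ) ≤ 2 ^ (turanExp r (s \ J).card + Λ)) :
    ((stubborn q r (l + 1) s).card : ℝ) ≤
      2 ^ (turanExp r s.card + Λ - s.card / (200 * (r : ℝ) ^ 4)) := by
  have hr1 : (1 : ℝ) ≤ r := by exact_mod_cast H.hr
  have hr4 : (0 : ℝ) < (r : ℝ) ^ 4 := by positivity
  have hs : s.Nonempty := by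
    rw [← Finset.card_pos]
    exact_mod_cast H.w_pos.trans_le hw
  have hq := H.q_pos
  have hf : 1 ≤ f := by
    rw [H.hf]
    have := Nat.mul_le_mul hq H.hr
    nlinarith
  have hsu : (s.card : ℝ) + 1 ≤ 2 ^ lg := le_trans (by gcongr) H.hlg
  have key := _root_.card_stubborn_succ_le (l := l) (h := s.card / (100 * (r : ℝ) ^ 4)) (σ := σ)
    (lg := lg) (Λ := Λ) (s := s) H.hr H.hq H.hf ?_ (by field_simp) ?_ H.sigma_nonneg H.lg_nonneg
    (by linarith) ?_ (H.h3.trans hw) ?_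
  · convert key using 3
    field_simp
    norm_num
  · rw [le_div_iff₀ (by positivity)]
    linarith [H.h1]
  · intro G S
    have h1 := card_certs_le hq hf hs G S r
    calc ((certs q f s G S r).card : ℝ) ≤ ((s.card : ℝ) + 1) ^ ((3 * q) ^ r * f) := by
          exact_mod_cast h1
      _ ≤ (2 ^ lg) ^ ((3 * q) ^ r * f) := by gcongr
      _ = 2 ^ (((3 * q) ^ r * f : ℝ) * lg) := by
          rw [← Real.rpow_natCast, ← Real.rpow_mul (by norm_num)]
          push_cast
          ring_nf
      _ ≤ _ := Real.rpow_le_rpow_of_exponent_le (by norm_num) H.hσ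
  · rw [div_div, le_div_iff₀ (by positivity)]
    linarith [H.h2]
  · intro J hJ hJ0 hJq
    have h1 : ((s \ J).card : ℝ) = s.card - J.card := by
      have : ((s \ J).card : ℝ) + J.card = s.card := by
        exact_mod_cast Finset.card_sdiff_add_card_eq_card hJ
      linarith
    rw [← h1]
    exact ih J hJ hJ0 hJq

lemma Admissible.card_stubborn_zero_le {q f r u : ℕ} {σ lg w₀ Λ : ℝ}
    (H : Admissible q f r u σ lg w₀) (hΛ : w₀ ^ 2 ≤ Λ) (hΛ' : u * lg + 1 ≤ Λ) {s : Finset V}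
    (hu : s.card ≤ u) :
    ((stubborn q r 0 s).card : ℝ) ≤ 2 ^ (turanExp r s.card + Λ) := by
  induction hn : s.card using Nat.strong_induction_on generalizing s with
  | _ n ih =>
  subst hn
  have hr1 : (1 : ℝ) ≤ r := by exact_mod_cast H.hr
  have hT0 : 0 ≤ turanExp r s.card := by
    unfold turanExp
    have : 1 / (r : ℝ) ≤ 1 := by rw [div_le_one (by linarith)]; exact hr1
    have : 0 ≤ 1 - 1 / (r : ℝ) := by linarith
    positivity
  by_cases hw : w₀ ≤ s.card
  · have h1 := H.card_stubborn_succ_le (l := 0) (Λ := Λ) hu hw fun J hJ hJ0 _ => by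
      have hlt : (s \ J).card < s.card := by
        have := Finset.card_sdiff_add_card_eq_card hJ
        have := hJ0.card_pos
        omega
      exact ih _ hlt (by omega) rfl
    have h2 := card_le_of_proper H.hr H.hrlg
      ((stubborn q r 0 s).filter fun G => ∃ c : V → Fin r, IsProper G c)
      (s := s) fun G hG => ⟨(Finset.mem_filter.1 (Finset.mem_filter.1 hG).1).2.1,
        (Finset.mem_filter.1 hG).2⟩
    have h3 : (stubborn q r 0 s).card ≤ (stubborn q r 1 s).card +
        ((stubborn q r 0 s).filter fun G => ∃ c : V → Fin r, IsProper G c).card := by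
      refine (Finset.card_le_card fun G hG => ?_).trans (Finset.card_union_le _ _)
      by_cases hc : ∃ c : V → Fin r, IsProper G c
      · exact Finset.mem_union_right _ (Finset.mem_filter.2 ⟨hG, hc⟩)
      · refine Finset.mem_union_left _ (Finset.mem_filter.2 ⟨Finset.mem_univ _,
          (Finset.mem_filter.1 hG).2.1, (Finset.mem_filter.1 hG).2.2.1, fun J hJ => ?_⟩)
        have : J = ∅ := by rw [← Finset.card_eq_zero]; omega
        rw [this, isolate_empty]
        exact hc
    have h4 : (2 : ℝ) ^ (turanExp r s.card + Λ) = 2 ^ (turanExp r s.card + Λ - 1) +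
        2 ^ (turanExp r s.card + Λ - 1) := by
      rw [Real.rpow_sub (by norm_num) _ 1, Real.rpow_one]
      ring
    rw [h4]
    refine le_trans (by exact_mod_cast h3) (add_le_add (h1.trans ?_) (h2.trans ?_))
    · refine Real.rpow_le_rpow_of_exponent_le (by norm_num) ?_
      have : 1 ≤ s.card / (200 * (r : ℝ) ^ 4) := by
        rw [le_div_iff₀ (by positivity)]
        have := H.h2
        have := H.lg_nonneg
        have := H.sigma_nonneg
        have : (0 : ℝ) < (r : ℝ) ^ 4 := by positivity
        nlinarith
      linarith
    · refine Real.rpow_le_rpow_of_exponent_le (by norm_num) ?_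
      have : (s.card : ℝ) * lg ≤ u * lg := by
        have := H.lg_nonneg
        gcongr
      linarith
  · push Not at hw
    have h1 := card_le_two_pow_rows (stubborn q r 0 s) s ⊥ (fun _ => s) (fun G hG => by
      have hG := (Finset.mem_filter.1 hG).2.1
      ext a b
      simp only [isolate, SimpleGraph.bot_adj, iff_false]
      exact fun h => h.2.1 (hG a b h.1)) (fun G hG y _ =>
        ((Finset.mem_filter.1 hG).2.1).nbr_subset y) (b := s.card) (fun _ _ => le_rfl)
    refine h1.trans (Real.rpow_le_rpow_of_exponent_le (by norm_num) ?_)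
    have : (0 : ℝ) ≤ s.card := by positivity
    nlinarith

lemma Admissible.card_stubborn_le {q f r u : ℕ} {σ lg w₀ Λ w₁ : ℝ}
    (H : Admissible q f r u σ lg w₀) (hΛ : w₀ ^ 2 ≤ Λ) (hΛ' : u * lg + 1 ≤ Λ) (hw : w₀ ≤ w₁)
    (l : ℕ) {s : Finset V} (hu : s.card ≤ u) (hs : w₁ + l * q ≤ s.card) :
    ((stubborn q r l s).card : ℝ) ≤
      2 ^ (turanExp r s.card + (Λ - l * (w₁ / (200 * (r : ℝ) ^ 4)))) := by
  induction l generalizing s with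
  | zero => simpa using H.card_stubborn_zero_le hΛ hΛ' hu
  | succ l ih =>
    have h0 : (0 : ℝ) ≤ ((l + 1 : ℕ) : ℝ) * q := by positivity
    refine (H.card_stubborn_succ_le hu (by linarith) fun J hJ _ hJq => ih
      ((Finset.card_le_card Finset.sdiff_subset).trans hu) ?_).trans
        (Real.rpow_le_rpow_of_exponent_le (by norm_num) ?_)
    · have h1 : ((s \ J).card : ℝ) + J.card = s.card := by
        exact_mod_cast Finset.card_sdiff_add_card_eq_card hJ
      have h2 : (J.card : ℝ) ≤ q := by exact_mod_cast hJq
      push_cast at hs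
      linarith
    · have : w₁ / (200 * (r : ℝ) ^ 4) ≤ s.card / (200 * (r : ℝ) ^ 4) := by
        gcongr
        linarith
      push_cast
      linarith

end Totals

section Far

variable {V : Type*} [Fintype V] [DecidableEq V]

/-- Some colouring with `r` colours has at most `t` monochromatic edges. -/
def NearPartite (r : ℕ) (t : ℝ) (G : SimpleGraph V) : Prop :=
  ∃ (c : V → Fin r) (T : Finset (V × V)), (T.card : ℝ) ≤ t ∧
    ∀ a b, G.Adj a b → c a = c b → (a, b) ∈ T ∨ (b, a) ∈ T

lemma nearPartite_of_isolate {r D : ℕ} (hr : 1 ≤ r) {t : ℝ} {G : SimpleGraph V} {J : Finset V} {c : V → Fin r}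
    (hc : IsProper (isolate G J) c)
    (hD : ∀ v ∈ J, ∃ i, ((nbr G v \ J).filter fun z => c z = i).card ≤ D)
    (ht : (J.card * (J.card + D) : ℝ) ≤ t) : NearPartite r t G := by
  have : Nonempty (Fin r) := ⟨⟨0, hr⟩⟩
  choose! g hg using hD
  refine ⟨fun z => if z ∈ J then g z else c z, J.biUnion fun v =>
    (J ∪ ((nbr G v \ J).filter fun z => c z = g v)).image (Prod.mk v), le_trans ?_ ht, ?_⟩
  · have := Finset.card_biUnion_le_card_mul J (fun v =>
      (J ∪ ((nbr G v \ J).filter fun z => c z = g v)).image (Prod.mk v)) (J.card + D)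
      fun v hv => Finset.card_image_le.trans ((Finset.card_union_le _ _).trans
        (Nat.add_le_add_left (hg v hv) _))
    exact_mod_cast this
  · have key : ∀ a b, G.Adj a b → a ∈ J →
        g a = (if b ∈ J then g b else c b) → (a, b) ∈ J.biUnion fun v =>
          (J ∪ ((nbr G v \ J).filter fun z => c z = g v)).image (Prod.mk v) := by
      intro a b hab ha h
      refine Finset.mem_biUnion.2 ⟨a, ha, Finset.mem_image_of_mem _ ?_⟩
      by_cases hb : b ∈ J
      · exact Finset.mem_union_left _ hb
      · simp only [hb, if_false] at h
        exact Finset.mem_union_right _ (Finset.mem_filter.2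
          ⟨Finset.mem_sdiff.2 ⟨mem_nbr.2 hab, hb⟩, h.symm⟩)
    intro a b hab h
    by_cases ha : a ∈ J
    · exact Or.inl (key a b hab ha (by simpa [ha] using h))
    by_cases hb : b ∈ J
    · exact Or.inr (key b a hab.symm hb (by simpa [hb] using h.symm))
    · exact absurd (by simpa [ha, hb] using h) (hc a b ⟨hab, ha, hb⟩)

lemma exists_transversal_clique {ι : Type*} [DecidableEq ι] [Nonempty V] {G : SimpleGraph V}
    {m L R : ℕ}
    (hm : 1 ≤ m) (I : Finset ι) (hI : I.card ≤ R) (A : ι → Finset V)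
    (hA : ∀ i ∈ I, R * m * L ^ I.card ≤ (A i).card) (hL : 1 ≤ L)
    (hP : ∀ i ∈ I, ∀ j ∈ I, i ≠ j → ∀ X ⊆ A i, ∀ B ⊆ A j, X.card = m → m ≤ B.card →
      ∃ y ∈ X, B.card ≤ (nbr G y ∩ B).card * L) :
    ∃ f : ι → V, (∀ i ∈ I, f i ∈ A i) ∧ ∀ i ∈ I, ∀ j ∈ I, i ≠ j → G.Adj (f i) (f j) := by
  induction I using Finset.induction_on generalizing A with
  | empty => exact ⟨fun _ => Classical.arbitrary V, by simp, by simp⟩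
  | insert i I hi ih =>
    rw [Finset.card_insert_of_notMem hi] at hI hA
    have hRm : ∀ j ∈ insert i I, R * m ≤ (A j).card := fun j hj =>
      (Nat.le_mul_of_pos_right _ (by positivity)).trans (hA j hj)
    have hmR : m ≤ R * m := Nat.le_mul_of_pos_left _ (by omega)
    obtain ⟨y, hy, hgood⟩ : ∃ y ∈ A i, ∀ j ∈ I, (A j).card ≤ (nbr G y ∩ A j).card * L := by
      by_contra! hcon
      have h1 : A i ⊆ I.biUnion fun j => (A i).filter fun y =>
          (nbr G y ∩ A j).card * L < (A j).card := fun y hy => by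
        obtain ⟨j, hj, h⟩ := hcon y hy
        exact Finset.mem_biUnion.2 ⟨j, hj, Finset.mem_filter.2 ⟨hy, h⟩⟩
      have h2 : (A i).card ≤ I.card * m := by
        refine (Finset.card_le_card h1).trans (Finset.card_biUnion_le_card_mul _ _ _
          fun j hj => ?_)
        by_contra! hlt
        obtain ⟨X, hX, hXm⟩ := Finset.exists_subset_card_eq hlt.le
        have hij : i ≠ j := fun h => hi (h ▸ hj)
        obtain ⟨y, hy, h⟩ := hP i (Finset.mem_insert_self _ _) j (Finset.mem_insert_of_mem hj) hij
          X (hX.trans (Finset.filter_subset _ _)) (A j) subset_rfl hXm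
          (hmR.trans (hRm j (Finset.mem_insert_of_mem hj)))
        have := (Finset.mem_filter.1 (hX hy)).2
        omega
      have h3 := hRm i (Finset.mem_insert_self _ _)
      have h4 : (I.card + 1) * m ≤ R * m := Nat.mul_le_mul_right _ hI
      nlinarith
    obtain ⟨f, hf1, hf2⟩ := ih (by omega) (fun j => nbr G y ∩ A j) (fun j hj => by
      have h1 := hgood j hj
      have h2 := hA j (Finset.mem_insert_of_mem hj)
      refine Nat.le_of_mul_le_mul_right ?_ hL
      calc R * m * L ^ I.card * L = R * m * L ^ (I.card + 1) := by ring
        _ ≤ _ := h2.trans h1)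
      fun a ha b hb hab X hX B hB => hP a (Finset.mem_insert_of_mem ha) b
        (Finset.mem_insert_of_mem hb) hab X (hX.trans Finset.inter_subset_right) B
          (hB.trans Finset.inter_subset_right)
    have hyf : ∀ j ∈ I, G.Adj y (f j) := fun j hj =>
      mem_nbr.1 (Finset.mem_inter.1 (hf1 j hj)).1
    have hne : ∀ j ∈ I, j ≠ i := fun j hj h => hi (h ▸ hj)
    refine ⟨fun j => if j = i then y else f j, fun j hj => ?_, fun a ha b hb hab => ?_⟩
    · rcases Finset.mem_insert.1 hj with rfl | hj
      · simpa using hy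
      · simpa [hne j hj] using (Finset.mem_inter.1 (hf1 j hj)).2
    · rcases Finset.mem_insert.1 ha with rfl | ha' <;>
        rcases Finset.mem_insert.1 hb with rfl | hb'
      · exact absurd rfl hab
      · simpa [hne b hb'] using hyf b hb'
      · simpa [hne a ha'] using (hyf a ha').symm
      · simpa [hne a ha', hne b hb'] using hf2 a ha' b hb' hab

/-- The pair `X`, `B` of differently coloured sets spans few edges of `G`. -/
def SparsePair {r : ℕ} (m L : ℕ) (G : SimpleGraph V) (c : V → Fin r) (X B : Finset V) : Prop :=
  X.card = m ∧ m ≤ B.card ∧ (∀ x ∈ X, ∀ b ∈ B, c x ≠ c b) ∧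
    ∀ y ∈ X, (nbr G y ∩ B).card * L < B.card

lemma exists_sparsePair {r m L D : ℕ} (hr : 1 ≤ r) {t : ℝ} {s J : Finset V} {G : SimpleGraph V}
    {c : V → Fin r} (hG : LivesOn s G) (hfree : G.CliqueFree (r + 1)) (hfar : ¬ NearPartite r t G)
    (hc : IsProper (isolate G J) c) (hm : 1 ≤ m) (hL : 1 ≤ L) (hD : r * m * L ^ r ≤ D + 1)
    (ht : (J.card * (J.card + D) : ℝ) ≤ t) :
    ∃ X ⊆ s \ J, ∃ B ⊆ s \ J, SparsePair m L G c X B := by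
  by_contra! hcon
  refine hfar (nearPartite_of_isolate hr hc (fun v _ => ?_) ht)
  by_contra! hlt
  have : Nonempty V := ⟨v⟩
  have hsub : ∀ i, ((nbr G v \ J).filter fun z => c z = i) ⊆ s \ J := fun i =>
    (Finset.filter_subset _ _).trans (Finset.sdiff_subset_sdiff (hG.nbr_subset v) le_rfl)
  obtain ⟨g, hg1, hg2⟩ := exists_transversal_clique (G := G) hm (Finset.univ : Finset (Fin r))
    (R := r) (by simp) (fun i => (nbr G v \ J).filter fun z => c z = i)
    (fun i _ => by simpa using hD.trans (hlt i)) hL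
    fun i _ j _ hij X hX B hB hXm hBm => by
      by_contra! hsp
      refine hcon X (hX.trans (hsub i)) B (hB.trans (hsub j)) ⟨hXm, hBm, fun x hx b hb => ?_, hsp⟩
      rw [(Finset.mem_filter.1 (hX hx)).2, (Finset.mem_filter.1 (hB hb)).2]
      exact hij
  have hinj : Function.Injective g := fun i j h => by
    by_contra hij
    exact (hg2 i (Finset.mem_univ _) j (Finset.mem_univ _) hij).ne h
  have hvg : ∀ i, G.Adj v (g i) := fun i =>
    mem_nbr.1 (Finset.mem_sdiff.1 (Finset.mem_filter.1 (hg1 i (Finset.mem_univ _))).1).1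
  refine hfree (insert v (Finset.univ.image g)) ⟨?_, ?_⟩
  · rw [Finset.coe_insert, SimpleGraph.isClique_insert]
    refine ⟨?_, fun b hb _ => ?_⟩
    · intro a ha b hb hab
      simp only [Finset.coe_image, Finset.coe_univ, Set.image_univ, Set.mem_range] at ha hb
      obtain ⟨i, rfl⟩ := ha
      obtain ⟨j, rfl⟩ := hb
      exact hg2 i (Finset.mem_univ _) j (Finset.mem_univ _) fun h => hab (h ▸ rfl)
    · simp only [Finset.coe_image, Finset.coe_univ, Set.image_univ, Set.mem_range] at hb
      obtain ⟨i, rfl⟩ := hb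
      exact hvg i
  · rw [Finset.card_insert_of_notMem, Finset.card_image_of_injective _ hinj]
    · simp
    · intro h
      obtain ⟨i, _, hi⟩ := Finset.mem_image.1 h
      exact (hvg i).ne hi.symm

lemma card_small_subsets_le (B : Finset V) {L : ℕ} {lg : ℝ} (hlg : (B.card : ℝ) + 1 ≤ 2 ^ lg)
    (hL : 2 * lg ≤ L) (hL1 : 1 ≤ L) :
    ((B.powerset.filter fun S => S.card * L < B.card).card : ℝ) ≤ 2 ^ ((B.card : ℝ) / 2) := by
  set a := B.card / L with ha
  have h1 : (B.powerset.filter fun S => S.card * L < B.card) ⊆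
      (Fintype.piFinset fun _ : Fin a => B.insertNone).image
        fun g => B.filter fun v => ∃ j, g j = some v := by
    intro S hS
    obtain ⟨hSB, hSL⟩ := Finset.mem_filter.1 hS
    rw [Finset.mem_powerset] at hSB
    have hSa : S.card ≤ a := (Nat.le_div_iff_mul_le hL1).2 hSL.le
    refine Finset.mem_image.2 ⟨fun j => if h : j.1 < S.card then
      some (S.equivFin.symm ⟨j, h⟩ : V) else none, ?_, ?_⟩
    · refine Fintype.mem_piFinset.2 fun j => ?_
      by_cases h : j.1 < S.card
      · simpa [h] using hSB (S.equivFin.symm ⟨j, h⟩).2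
      · simp [h]
    · ext v
      simp only [Finset.mem_filter]
      constructor
      · rintro ⟨_, j, hj⟩
        by_cases h : j.1 < S.card
        · simp only [h, dif_pos, Option.some.injEq] at hj
          exact hj ▸ (S.equivFin.symm ⟨j, h⟩).2
        · simp [h] at hj
      · intro hv
        refine ⟨hSB hv, ⟨S.equivFin ⟨v, hv⟩, (S.equivFin ⟨v, hv⟩).2.trans_le hSa⟩, ?_⟩
        simp
  have h2 := (Finset.card_le_card h1).trans Finset.card_image_le
  rw [Fintype.card_piFinset] at h2
  simp only [Finset.card_insertNone, Finset.prod_const, Finset.card_univ, Fintype.card_fin] at h2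
  calc ((B.powerset.filter fun S => S.card * L < B.card).card : ℝ) ≤ ((B.card : ℝ) + 1) ^ a := by
        exact_mod_cast h2
    _ ≤ (2 ^ lg) ^ a := by gcongr
    _ = 2 ^ (lg * a) := by rw [← Real.rpow_natCast, ← Real.rpow_mul (by norm_num)]
    _ ≤ _ := by
      refine Real.rpow_le_rpow_of_exponent_le (by norm_num) ?_
      have h3 : (a : ℝ) * L ≤ B.card := by exact_mod_cast Nat.div_mul_le_self _ _
      have h4 : (0 : ℝ) ≤ a := by positivity
      nlinarith

/-- The graph `K` without the edges between `X` and `B`. -/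
def cutEdges (K : SimpleGraph V) (X B : Finset V) : SimpleGraph V where
  Adj a b := K.Adj a b ∧ ¬ (a ∈ X ∧ b ∈ B) ∧ ¬ (b ∈ X ∧ a ∈ B)
  symm := ⟨fun _ _ h => ⟨h.1.symm, h.2.2, h.2.1⟩⟩
  loopless := ⟨fun _ h => h.1.ne rfl⟩

lemma cutEdges_mono {K K' : SimpleGraph V} (h : K ≤ K') (X B : Finset V) :
    cutEdges K X B ≤ cutEdges K' X B := fun _ _ hab => ⟨h hab.1, hab.2⟩

lemma eq_of_cutEdges_eq {K K' : SimpleGraph V} {X B : Finset V}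
    (h : cutEdges K X B = cutEdges K' X B) (hrow : ∀ y ∈ X, nbr K y ∩ B = nbr K' y ∩ B) :
    K = K' := by
  have hr : ∀ y ∈ X, ∀ z ∈ B, (K.Adj y z ↔ K'.Adj y z) := fun y hy z hz => by
    have := congrArg (z ∈ ·) (hrow y hy)
    simpa [hz] using this
  ext a b
  by_cases h1 : a ∈ X ∧ b ∈ B
  · exact hr a h1.1 b h1.2
  by_cases h2 : b ∈ X ∧ a ∈ B
  · rw [K.adj_comm, K'.adj_comm]; exact hr b h2.1 a h2.2
  have : (cutEdges K X B).Adj a b ↔ (cutEdges K' X B).Adj a b := by rw [h]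
  simpa only [cutEdges, h1, h2, not_false_eq_true, and_true] using this

lemma card_edgeFinset_cutEdges {K : SimpleGraph V} {X B : Finset V}
    (hdisj : Disjoint X B) (hK : ∀ x ∈ X, ∀ b ∈ B, K.Adj x b) :
    (cutEdges K X B).edgeFinset.card + X.card * B.card ≤ K.edgeFinset.card := by
  have hinj : ((X ×ˢ B).image fun p => s(p.1, p.2)).card = X.card * B.card := by
    rw [Finset.card_image_of_injOn, Finset.card_product]
    rintro ⟨a, b⟩ hab ⟨a', b'⟩ hab' h
    simp only [Finset.coe_product, Set.mem_prod, Finset.mem_coe] at hab hab'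
    rcases Sym2.eq_iff.1 h with ⟨h1, h2⟩ | ⟨h1, h2⟩
    · exact Prod.ext h1 h2
    · exact absurd hab.1 (Finset.disjoint_right.1 hdisj ((show a = b' from h1) ▸ hab'.2))
  rw [← hinj, ← Finset.card_union_of_disjoint]
  · refine Finset.card_le_card (Finset.union_subset
      (SimpleGraph.edgeFinset_mono fun _ _ h => h.1) fun e he => ?_)
    obtain ⟨p, hp, rfl⟩ := Finset.mem_image.1 he
    rw [Finset.mem_product] at hp
    simpa using hK _ hp.1 _ hp.2
  · refine Finset.disjoint_right.2 fun e he h => ?_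
    obtain ⟨p, hp, rfl⟩ := Finset.mem_image.1 he
    rw [Finset.mem_product] at hp
    rw [SimpleGraph.mem_edgeFinset, SimpleGraph.mem_edgeSet] at h
    exact h.2.1 hp

lemma card_le_of_sparsePair_fixed {r m L : ℕ} (hr : 1 ≤ r) {lg : ℝ} {s J X B : Finset V}
    {c : V → Fin r}
    (hlg : (s.card : ℝ) + 1 ≤ 2 ^ lg) (hL : 2 * lg ≤ L) (hL1 : 1 ≤ L)
    (hX : X ⊆ s \ J) (hB : B ⊆ s \ J) (F : Finset (SimpleGraph V))
    (hF : ∀ G ∈ F, LivesOn s G ∧ IsProper (isolate G J) c ∧ SparsePair m L G c X B) :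
    (F.card : ℝ) ≤ 2 ^ (turanExp r s.card - (m : ℝ) ^ 2 / 2 + J.card * s.card) := by
  rcases F.eq_empty_or_nonempty with rfl | ⟨G₀, hG₀⟩
  · simp only [Finset.card_empty, Nat.cast_zero]
    positivity
  obtain ⟨-, -, hXm, hBm, hcol, -⟩ := hF G₀ hG₀
  set K := cutEdges (multipartiteOn s c) X B with hK
  have hXs := hX.trans Finset.sdiff_subset
  have hBs := hB.trans Finset.sdiff_subset
  have h1 : F.card ≤ (K.edgeFinset.powerset ×ˢ
      (Fintype.piFinset fun _ : X => B.powerset.filter fun S => S.card * L < B.card) ×ˢ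
      (Fintype.piFinset fun _ : J => s.powerset)).card := by
    refine Finset.card_le_card_of_injOn (fun G => ((cutEdges (isolate G J) X B).edgeFinset,
      (fun y => nbr G y ∩ B), fun y => nbr G y)) (fun G hG => ?_) ?_
    · obtain ⟨h1, h2, h3⟩ := hF G hG
      refine Finset.mem_product.2 ⟨Finset.mem_powerset.2 ?_, Finset.mem_product.2
        ⟨Fintype.mem_piFinset.2 fun y => Finset.mem_filter.2 ⟨?_, ?_⟩,
          Fintype.mem_piFinset.2 fun y => ?_⟩⟩
      · exact SimpleGraph.edgeFinset_mono (cutEdges_mono (LivesOn.le_multipartiteOn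
          (fun a b h => h1 a b (isolate_le G J h)) h2) X B)
      · exact Finset.mem_powerset.2 Finset.inter_subset_right
      · exact h3.2.2.2 y y.2
      · exact Finset.mem_powerset.2 (h1.nbr_subset y)
    · intro G hG G' hG' h
      simp only [Prod.mk.injEq] at h
      obtain ⟨h1, h2, h3⟩ := h
      refine eq_of_isolate_eq (J := J) (eq_of_cutEdges_eq (SimpleGraph.edgeFinset_inj.1 h1)
        fun y hy => ?_) fun y hy => congrFun h3 ⟨y, hy⟩
      have hyJ := (Finset.mem_sdiff.1 (hX hy)).2
      have hiso : ∀ G : SimpleGraph V, nbr (isolate G J) y ∩ B = nbr G y ∩ B := fun G => by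
        ext z
        simp only [Finset.mem_inter, mem_nbr, isolate]
        refine and_congr_left fun hz => ?_
        simp [hyJ, (Finset.mem_sdiff.1 (hB hz)).2]
      rw [hiso, hiso]
      exact congrFun h2 ⟨y, hy⟩
  have h2 : (K.edgeFinset.card : ℝ) + m * B.card ≤ turanExp r s.card := by
    refine le_trans ?_ (card_edgeFinset_multipartiteOn_le hr s c)
    rw [← hXm]
    exact_mod_cast card_edgeFinset_cutEdges (K := multipartiteOn s c)
      (Finset.disjoint_left.2 fun x hx hb => hcol x hx x hb rfl)
      fun x hx b hb => ⟨hXs hx, hBs hb, hcol x hx b hb⟩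
  have h3 := card_small_subsets_le B (L := L) (lg := lg) (le_trans (by
    have : (B.card : ℝ) ≤ s.card := by exact_mod_cast Finset.card_le_card hBs
    linarith) hlg) hL hL1
  rw [Finset.card_product, Finset.card_product, Fintype.card_piFinset, Fintype.card_piFinset,
    Finset.prod_const, Finset.prod_const, Finset.card_powerset, Finset.card_powerset,
    Finset.card_univ, Finset.card_univ, Fintype.card_coe, Fintype.card_coe, hXm] at h1
  calc (F.card : ℝ) ≤ 2 ^ K.edgeFinset.card * (((B.powerset.filter fun S =>
        S.card * L < B.card).card : ℝ) ^ m * (2 ^ s.card) ^ J.card) := by exact_mod_cast h1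
    _ ≤ 2 ^ K.edgeFinset.card * (((2 : ℝ) ^ ((B.card : ℝ) / 2)) ^ m *
        (2 ^ s.card) ^ J.card) := by gcongr
    _ = 2 ^ ((K.edgeFinset.card : ℝ) + B.card / 2 * m + J.card * s.card) := by
      rw [Real.rpow_add (by norm_num), Real.rpow_add (by norm_num), Real.rpow_natCast,
        Real.rpow_mul (by norm_num), Real.rpow_natCast, mul_comm (J.card : ℝ),
        Real.rpow_mul (by norm_num), Real.rpow_natCast, Real.rpow_natCast]
      ring
    _ ≤ _ := by
      refine Real.rpow_le_rpow_of_exponent_le (by norm_num) ?_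
      have h4 : (m : ℝ) ≤ B.card := by exact_mod_cast hBm
      have h5 : (0 : ℝ) ≤ m := by positivity
      nlinarith

lemma card_le_of_sparsePair {r m L j : ℕ} (hr : 1 ≤ r) {lg : ℝ} {s : Finset V}
    (hlg : (s.card : ℝ) + 1 ≤ 2 ^ lg) (hrlg : (r : ℝ) ≤ 2 ^ lg) (hL : 2 * lg ≤ L) (hL1 : 1 ≤ L)
    (F : Finset (SimpleGraph V))
    (hF : ∀ G ∈ F, LivesOn s G ∧ ∃ J ⊆ s, J.card ≤ j ∧ ∃ c : V → Fin r,
      IsProper (isolate G J) c ∧ ∃ X ⊆ s \ J, ∃ B ⊆ s \ J, SparsePair m L G c X B) :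
    (F.card : ℝ) ≤
      2 ^ (turanExp r s.card - (m : ℝ) ^ 2 / 2 + j * s.card + s.card * (lg + 3)) := by
  refine (card_le_of_cover (((Finset.univ : Finset (s → Fin r)) ×ˢ s.powerset) ×ˢ
      (s.powerset ×ˢ s.powerset)) F
    (fun i G => LivesOn s G ∧ i.1.2 ⊆ s ∧ i.1.2.card ≤ j ∧ i.2.1 ⊆ s \ i.1.2 ∧
      i.2.2 ⊆ s \ i.1.2 ∧ IsProper (isolate G i.1.2) (extendColoring hr s i.1.1) ∧
      SparsePair m L G (extendColoring hr s i.1.1) i.2.1 i.2.2) (fun G hG => ?_)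
    (N := 2 ^ (turanExp r s.card - (m : ℝ) ^ 2 / 2 + j * s.card)) fun i _ F' _ hF' => ?_).trans ?_
  · obtain ⟨h1, J, hJ, hJj, c, hc, X, hX, B, hB, hm, hmB, hcol, hsp⟩ := hF G hG
    refine ⟨((fun v => c v, J), (X, B)), ?_, h1, hJ, hJj, hX, hB, ?_, hm, hmB, ?_, hsp⟩
    · simp only [Finset.mem_product, Finset.mem_univ, Finset.mem_powerset, true_and]
      exact ⟨hJ, hX.trans Finset.sdiff_subset, hB.trans Finset.sdiff_subset⟩
    · exact hc.extendColoring hr fun a b h => h1 a b h.1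
    · intro x hx b hb
      have hx' := (Finset.mem_sdiff.1 (hX hx)).1
      have hb' := (Finset.mem_sdiff.1 (hB hb)).1
      simpa [extendColoring, hx', hb'] using hcol x hx b hb
  · rcases F'.eq_empty_or_nonempty with rfl | ⟨G₀, hG₀⟩
    · simp only [Finset.card_empty, Nat.cast_zero]
      positivity
    obtain ⟨-, -, hJj, hX, hB, -⟩ := hF' G₀ hG₀
    refine (card_le_of_sparsePair_fixed hr hlg hL hL1 hX hB F' fun G hG => ⟨(hF' G hG).1,
      (hF' G hG).2.2.2.2.2⟩).trans (Real.rpow_le_rpow_of_exponent_le (by norm_num) ?_)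
    have : (i.1.2.card : ℝ) ≤ j := by exact_mod_cast hJj
    gcongr
  · have h1 : ((((Finset.univ : Finset (s → Fin r)) ×ˢ s.powerset) ×ˢ
        (s.powerset ×ˢ s.powerset)).card : ℝ) ≤ 2 ^ (s.card * (lg + 3)) := by
      rw [mul_comm, Real.rpow_mul (by norm_num), Real.rpow_natCast,
        Real.rpow_add (by norm_num)]
      simp only [Finset.card_product, Finset.card_powerset, Finset.card_univ, Fintype.card_fun,
        Fintype.card_coe, Fintype.card_fin]
      push_cast
      rw [mul_pow, show (2 : ℝ) ^ (3 : ℝ) = 2 * 2 * 2 by norm_num, mul_pow, mul_pow]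
      calc (r : ℝ) ^ s.card * 2 ^ s.card * (2 ^ s.card * 2 ^ s.card)
          = (r : ℝ) ^ s.card * (2 ^ s.card * 2 ^ s.card * 2 ^ s.card) := by ring
        _ ≤ _ := by gcongr
    rw [Real.rpow_add (by norm_num) _ (s.card * (lg + 3)), mul_comm]
    gcongr

/-- The `K_{r+1}`-free graphs on `s` that are far from `r`-partite. -/
noncomputable def farFree (r : ℕ) (t : ℝ) (s : Finset V) : Finset (SimpleGraph V) :=
  Finset.univ.filter fun G => LivesOn s G ∧ G.CliqueFree (r + 1) ∧ ¬ NearPartite r t G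

lemma card_farFree_le {q r l m L D : ℕ} {t lg : ℝ} (hr : 1 ≤ r) {s : Finset V}
    (hlg : (s.card : ℝ) + 1 ≤ 2 ^ lg) (hrlg : (r : ℝ) ≤ 2 ^ lg) (hL : 2 * lg ≤ L) (hL1 : 1 ≤ L)
    (hm : 1 ≤ m) (hD : r * m * L ^ r ≤ D + 1) (ht : (l * q * (l * q + D) : ℝ) ≤ t) :
    ((farFree r t s).card : ℝ) ≤ (stubborn q r l s).card +
      2 ^ (turanExp r s.card - (m : ℝ) ^ 2 / 2 + l * q * s.card + s.card * (lg + 3)) := by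
  have h1 : (farFree r t s).card ≤ (stubborn q r l s).card +
      ((farFree r t s) \ stubborn q r l s).card := by
    refine (Finset.card_le_card fun G hG => ?_).trans (Finset.card_union_le _ _)
    by_cases h : G ∈ stubborn q r l s
    · exact Finset.mem_union_left _ h
    · exact Finset.mem_union_right _ (Finset.mem_sdiff.2 ⟨hG, h⟩)
  have h2 := card_le_of_sparsePair (m := m) (j := l * q) hr hlg hrlg hL hL1
    ((farFree r t s) \ stubborn q r l s) fun G hG => by
      obtain ⟨hG1, hG2⟩ := Finset.mem_sdiff.1 hG
      obtain ⟨-, hG, hfree, hfar⟩ := Finset.mem_filter.1 hG1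
      simp only [stubborn, Finset.mem_filter, Finset.mem_univ, true_and, hG, hfree, not_forall,
        not_not] at hG2
      obtain ⟨J, hJ, c, hc⟩ := hG2
      have hJl : (J ∩ s).card ≤ l * q :=
        (Finset.card_le_card Finset.inter_subset_left).trans (by omega)
      have hc' : IsProper (isolate G (J ∩ s)) c := fun a b h => by
        have ha := hG a b h.1
        have hb := hG b a h.1.symm
        exact hc a b ⟨h.1, fun h' => h.2.1 (Finset.mem_inter.2 ⟨h', ha⟩),
          fun h' => h.2.2 (Finset.mem_inter.2 ⟨h', hb⟩)⟩
      refine ⟨hG, J ∩ s, Finset.inter_subset_right, hJl, c, hc',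
        exists_sparsePair hr hG hfree hfar hc' hm hL1 hD (le_trans ?_ ht)⟩
      have : ((J ∩ s).card : ℝ) ≤ l * q := by exact_mod_cast hJl
      gcongr
  push_cast at h2
  refine le_trans (by exact_mod_cast h1) (add_le_add le_rfl h2)

end Far

section Transfer

variable {V : Type*} [Fintype V] [DecidableEq V]

lemma card_restriction_mul_le (s : Finset V) (F : Finset (SimpleGraph V)) :
    (Finset.univ.filter fun G : SimpleGraph V => isolate G sᶜ ∈ F).card * 2 ^ s.card.choose 2 ≤
      F.card * Fintype.card (SimpleGraph V) := by
  have h1 : Fintype.card (Finset (↑(⊤ : SimpleGraph s).edgeFinset)) = 2 ^ s.card.choose 2 := by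
    rw [Fintype.card_finset, Fintype.card_coe, SimpleGraph.card_edgeFinset_top_eq_card_choose_two,
      Fintype.card_coe]
  have h2 : 2 ^ s.card.choose 2 ≤ Fintype.card (SimpleGraph s) := by
    rw [← h1]
    refine Fintype.card_le_of_injective (fun E => SimpleGraph.fromEdgeSet
      ((E.map (Function.Embedding.subtype _) : Finset (Sym2 s)) : Set (Sym2 s))) ?_
    intro E E' h
    have h3 := congrArg SimpleGraph.edgeSet h
    have hd : ∀ E : Finset (↑(⊤ : SimpleGraph s).edgeFinset),
        (SimpleGraph.fromEdgeSet ((E.map (Function.Embedding.subtype _) : Finset (Sym2 s)) :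
          Set (Sym2 s))).edgeSet = (E.map (Function.Embedding.subtype _) : Finset (Sym2 s)) := by
      intro E
      rw [SimpleGraph.edgeSet_fromEdgeSet, sdiff_eq_left, Set.disjoint_left]
      intro e he
      obtain ⟨⟨e', he'⟩, -, rfl⟩ := Finset.mem_map.1 (Finset.mem_coe.1 he)
      simpa using he'
    rw [hd, hd, Finset.coe_inj] at h3
    exact Finset.map_injective _ h3
  refine (Nat.mul_le_mul_left _ h2).trans ?_
  rw [← Finset.card_univ, ← Finset.card_univ, ← Finset.card_product, ← Finset.card_product]
  let Ψ : SimpleGraph V → SimpleGraph s → SimpleGraph V := fun G H =>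
    { Adj := fun a b => (G.Adj a b ∧ (a ∉ s ∨ b ∉ s)) ∨
        ∃ (ha : a ∈ s) (hb : b ∈ s), H.Adj ⟨a, ha⟩ ⟨b, hb⟩
      symm := ⟨fun a b h => h.imp (fun h => ⟨h.1.symm, h.2.symm⟩)
        fun ⟨ha, hb, h⟩ => ⟨hb, ha, h.symm⟩⟩
      loopless := ⟨fun a h => h.elim (fun h => h.1.ne rfl) fun ⟨_, _, h⟩ => h.ne rfl⟩ }
  refine Finset.card_le_card_of_injOn (fun p => (isolate p.1 sᶜ, Ψ p.1 p.2)) (fun p hp => ?_) ?_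
  · have := (Finset.mem_filter.1 (Finset.mem_product.1 hp).1).2
    exact Finset.mem_product.2 ⟨this, Finset.mem_univ _⟩
  · rintro ⟨G, H⟩ _ ⟨G', H'⟩ _ h
    obtain ⟨h1, h2⟩ := Prod.ext_iff.1 h
    have hin : ∀ a b, (isolate G sᶜ).Adj a b ↔ (isolate G' sᶜ).Adj a b := fun a b => by
      rw [show isolate G sᶜ = isolate G' sᶜ from h1]
    have hΨ : ∀ a b, (Ψ G H).Adj a b ↔ (Ψ G' H').Adj a b := fun a b => by
      rw [show Ψ G H = Ψ G' H' from h2]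
    refine Prod.ext ?_ ?_
    · ext a b
      by_cases hs : a ∈ s ∧ b ∈ s
      · simpa [isolate, hs.1, hs.2] using hin a b
      · have h3 : a ∉ s ∨ b ∉ s := by tauto
        have h4 : ∀ H : SimpleGraph s, ¬∃ (ha : a ∈ s) (hb : b ∈ s), H.Adj ⟨a, ha⟩ ⟨b, hb⟩ :=
          fun H ⟨ha, hb, _⟩ => hs ⟨ha, hb⟩
        simpa only [Ψ, h3, h4, and_true, or_false] using hΨ a b
    · ext a b
      simpa [Ψ] using hΨ a b

end Transfer

lemma mem_farFree_of_induce {n r : ℕ} {t : ℝ} (hr : 1 ≤ r) {G : SimpleGraph (Fin n)}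
    {s : Finset (Fin n)} (hfree : (G.induce (s : Set (Fin n))).CliqueFree (r + 1))
    (hfar : FarFromPartite G s r t) : isolate G sᶜ ∈ farFree r t s := by
  refine Finset.mem_filter.2 ⟨Finset.mem_univ _, fun a b h => by simpa using h.2.1, ?_, ?_⟩
  · have h1 : isolate G sᶜ = (G.induce (s : Set (Fin n))).map (Function.Embedding.subtype _) := by
      ext a b
      rw [SimpleGraph.map_adj]
      simp [isolate, and_comm, and_left_comm, and_assoc]
    rw [h1]
    intro K hK
    obtain ⟨K', hK', -⟩ := (SimpleGraph.isNClique_map_iff (by omega)).1 hK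
    exact hfree K' hK'
  · rintro ⟨c, T, hT, hcov⟩
    refine absurd (hfar c) (not_lt.2 (le_trans ?_ hT))
    have h2 : {e ∈ G.edgeSet | (∀ v ∈ e, v ∈ s) ∧ ∃ i, ∀ v ∈ e, c v = i} ⊆
        ((T.image fun p => s(p.1, p.2) : Finset (Sym2 (Fin n))) : Set (Sym2 (Fin n))) := by
      rintro e
      induction e using Sym2.ind with
      | _ a b =>
      rintro ⟨hab, hs, i, hi⟩
      have ha := hs a (Sym2.mem_mk_left _ _)
      have hb := hs b (Sym2.mem_mk_right _ _)
      have hc : c a = c b :=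
        (hi a (Sym2.mem_mk_left _ _)).trans (hi b (Sym2.mem_mk_right _ _)).symm
      rcases hcov a b ⟨hab, by simpa using ha, by simpa using hb⟩ hc with h | h
      · exact Finset.mem_coe.2 (Finset.mem_image.2 ⟨_, h, rfl⟩)
      · exact Finset.mem_coe.2 (Finset.mem_image.2 ⟨_, h, Sym2.eq_swap⟩)
    have h3 := Set.ncard_le_ncard h2 (Finset.finite_toSet _)
    rw [Set.ncard_coe_finset] at h3
    exact_mod_cast h3.trans Finset.card_image_le

lemma grPr_eq (n : ℕ) (S : Set (SimpleGraph (Fin n))) :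
    grPr n S = ((Finset.univ.filter fun G => G ∈ S).card : ℝ) /
      Fintype.card (SimpleGraph (Fin n)) := by
  unfold grPr
  rw [PMF.toOuterMeasure_uniformOfFintype_apply]
  simp [Fintype.card_subtype]

lemma grPr_exists_far_le {n k r : ℕ} {t M : ℝ} (hr : 1 ≤ r) (hn : 1 ≤ n) (hM0 : 0 ≤ M)
    (hM : ∀ u, k * r ≤ u → u ≤ (k + 1) * r → ∀ s : Finset (Fin n), s.card = u →
      ((farFree r t s).card : ℝ) * n ^ u ≤ M * 2 ^ u.choose 2) :
    grPr n {G | ∃ u : ℕ, k * r ≤ u ∧ u ≤ (k + 1) * r ∧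
      ∃ s : Finset (Fin n), s.card = u ∧ (G.induce (s : Set (Fin n))).CliqueFree (r + 1) ∧
        FarFromPartite G s r t} ≤ (r + 1) * M := by
  set S := {G : SimpleGraph (Fin n) | ∃ u : ℕ, k * r ≤ u ∧ u ≤ (k + 1) * r ∧
      ∃ s : Finset (Fin n), s.card = u ∧ (G.induce (s : Set (Fin n))).CliqueFree (r + 1) ∧
        FarFromPartite G s r t} with hS
  set Z : ℝ := ((Fintype.card (SimpleGraph (Fin n)) : ℕ) : ℝ) with hZ
  have hZ0 : 0 < Z := by
    rw [hZ]
    exact_mod_cast Fintype.card_pos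
  rw [grPr_eq, div_le_iff₀ hZ0]
  have h1 : (Finset.univ.filter fun G => G ∈ S) ⊆ (Finset.Icc (k * r) ((k + 1) * r)).biUnion
      fun u => (Finset.univ.powersetCard u).biUnion fun s =>
        Finset.univ.filter fun G => isolate G sᶜ ∈ farFree r t s := by
    intro G hG
    obtain ⟨u, hu1, hu2, s, hs, hfree, hfar⟩ := (Finset.mem_filter.1 hG).2
    refine Finset.mem_biUnion.2 ⟨u, Finset.mem_Icc.2 ⟨hu1, hu2⟩, Finset.mem_biUnion.2
      ⟨s, Finset.mem_powersetCard.2 ⟨Finset.subset_univ _, hs⟩, Finset.mem_filter.2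
        ⟨Finset.mem_univ _, mem_farFree_of_induce hr hfree hfar⟩⟩⟩
  have h2 : ∀ u ∈ Finset.Icc (k * r) ((k + 1) * r),
      (((Finset.univ.powersetCard u).biUnion fun s : Finset (Fin n) =>
        Finset.univ.filter fun G => isolate G sᶜ ∈ farFree r t s).card : ℝ) ≤ M * Z := by
    intro u hu
    rw [Finset.mem_Icc] at hu
    have h3 : ((Finset.univ.powersetCard u : Finset (Finset (Fin n))).card : ℝ) ≤ (n : ℝ) ^ u := by
      rw [Finset.card_powersetCard, Finset.card_univ, Fintype.card_fin]
      exact_mod_cast Nat.choose_le_pow n u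
    have hn0 : (0 : ℝ) < (n : ℝ) ^ u := by positivity
    calc (((Finset.univ.powersetCard u).biUnion fun s : Finset (Fin n) =>
          Finset.univ.filter fun G => isolate G sᶜ ∈ farFree r t s).card : ℝ)
        ≤ ∑ s ∈ Finset.univ.powersetCard u, ((Finset.univ.filter fun G : SimpleGraph (Fin n) =>
            isolate G sᶜ ∈ farFree r t s).card : ℝ) := by exact_mod_cast Finset.card_biUnion_le
      _ ≤ ∑ s ∈ (Finset.univ.powersetCard u : Finset (Finset (Fin n))), M * Z / n ^ u := by
          refine Finset.sum_le_sum fun s hs => ?_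
          have hsu := (Finset.mem_powersetCard.1 hs).2
          have h4 := hM u hu.1 hu.2 s hsu
          have h5 : ((Finset.univ.filter fun G : SimpleGraph (Fin n) =>
            isolate G sᶜ ∈ farFree r t s).card : ℝ) * 2 ^ u.choose 2 ≤
              (farFree r t s).card * Z := by
            rw [← hsu, hZ]
            exact_mod_cast card_restriction_mul_le s (farFree r t s)
          rw [le_div_iff₀ hn0]
          refine le_of_mul_le_mul_right ?_ (show (0 : ℝ) < 2 ^ u.choose 2 by positivity)
          calc _ = ((Finset.univ.filter fun G : SimpleGraph (Fin n) =>
                isolate G sᶜ ∈ farFree r t s).card : ℝ) * 2 ^ u.choose 2 * n ^ u := by ring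
            _ ≤ (farFree r t s).card * Z * n ^ u := by gcongr
            _ = (farFree r t s).card * n ^ u * Z := by ring
            _ ≤ M * 2 ^ u.choose 2 * Z := by gcongr
            _ = _ := by ring
      _ = (Finset.univ.powersetCard u : Finset (Finset (Fin n))).card * (M * Z / n ^ u) := by
          rw [Finset.sum_const, nsmul_eq_mul]
      _ ≤ n ^ u * (M * Z / n ^ u) := by gcongr
      _ = M * Z := by field_simp
  calc ((Finset.univ.filter fun G => G ∈ S).card : ℝ)
      ≤ ∑ u ∈ Finset.Icc (k * r) ((k + 1) * r),
        (((Finset.univ.powersetCard u).biUnion fun s : Finset (Fin n) =>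
          Finset.univ.filter fun G => isolate G sᶜ ∈ farFree r t s).card : ℝ) := by
        exact_mod_cast (Finset.card_le_card h1).trans Finset.card_biUnion_le
    _ ≤ ∑ u ∈ Finset.Icc (k * r) ((k + 1) * r), M * Z := Finset.sum_le_sum h2
    _ = (r + 1) * M * Z := by
      rw [Finset.sum_const, Nat.card_Icc, nsmul_eq_mul,
        show (k + 1) * r + 1 - k * r = r + 1 by rw [add_mul]; omega]
      push_cast
      ring

section Parameters

variable {V : Type*} [Fintype V] [DecidableEq V]

lemma admissible_of_large {r u : ℕ} {y z : ℝ} (hz : 3000 ≤ z) (hy : z ^ 20 ≤ y) (hr : 1 ≤ r)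
    (hrz : (r : ℝ) ≤ z) (hpow : z ^ (5 * r) ≤ y) (hexp : y ^ 200 ≤ 2 ^ (3 * z))
    (hu' : (u : ℝ) + 1 ≤ y ^ 102) :
    ∃ σ, Admissible (1000 * r ^ 4) (2 * (1000 * r ^ 4) * r) r u σ (3 * z) (y ^ 25) := by
  have hz1 : 1 ≤ z := by linarith
  have hz0 : 0 ≤ z := by linarith
  have hzy : ∀ i ≤ 20, z ^ i ≤ y := fun i hi => (pow_le_pow_right₀ hz1 hi).trans hy
  have hzy1 : z ≤ y := by simpa using hzy 1 (by norm_num)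
  have hy1 : 3000 ≤ y := hz.trans hzy1
  have hy0 : 0 ≤ y := by linarith
  have hyy : ∀ {i j : ℕ}, i ≤ j → y ^ i ≤ y ^ j := fun h => pow_le_pow_right₀ (by linarith) h
  have hr1 : (1 : ℝ) ≤ r := by exact_mod_cast hr
  have hr4 : (1 : ℝ) ≤ (r : ℝ) ^ 4 := one_le_pow₀ hr1
  have hrz4 : (r : ℝ) ^ 4 ≤ z ^ 4 := by gcongr
  set q : ℕ := 1000 * r ^ 4 with hq
  set f : ℕ := 2 * q * r with hf
  have hz4 : 1 ≤ z ^ 4 := one_le_pow₀ hz1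
  have hq3 : 3 * (q : ℝ) ≤ z ^ 5 := by
    rw [hq]
    push_cast
    calc 3 * (1000 * (r : ℝ) ^ 4) ≤ 3000 * z ^ 4 := by linarith
      _ ≤ z * z ^ 4 := by gcongr
      _ = z ^ 5 := by ring
  have hq0 : (0 : ℝ) ≤ q := by positivity
  have hqz : (q : ℝ) ≤ z ^ 5 := by linarith
  have hf7 : (f : ℝ) ≤ z ^ 7 := by
    rw [hf]
    push_cast
    calc 2 * (q : ℝ) * r ≤ z * z ^ 5 * z := by
          gcongr
          linarith
      _ = z ^ 7 := by ring
  have hf0 : (0 : ℝ) ≤ f := by positivity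
  have hqr : (3 * (q : ℝ)) ^ r ≤ y := by
    calc (3 * (q : ℝ)) ^ r ≤ (z ^ 5) ^ r := by gcongr
      _ = z ^ (5 * r) := by rw [pow_mul]
      _ ≤ y := hpow
  set σ : ℝ := ((3 * q) ^ r * f : ℝ) * (3 * z) with hσ
  have hσ0 : 0 ≤ σ := by positivity
  have hσy : σ ≤ y * z ^ 9 := by
    calc σ ≤ y * z ^ 7 * (z * z) := by
          rw [hσ]
          gcongr
          linarith
      _ = y * z ^ 9 := by ring
  refine ⟨σ, hr, rfl, rfl, ?_, ?_, le_rfl, ?_, ?_, ?_⟩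
  · exact hu'.trans ((hyy (by norm_num)).trans hexp)
  · calc (r : ℝ) ≤ y ^ 1 := by rw [pow_one]; exact hrz.trans hzy1
      _ ≤ y ^ 200 := hyy (by norm_num)
      _ ≤ _ := hexp
  · calc 100 * (r : ℝ) ^ 4 * f ≤ z * z ^ 4 * z ^ 7 := by
          gcongr
          linarith
      _ = z ^ 12 := by ring
      _ ≤ y ^ 1 := by rw [pow_one]; exact hzy 12 (by norm_num)
      _ ≤ _ := hyy (by norm_num)
  · have h9 : 1 ≤ z ^ 9 := one_le_pow₀ hz1
    have h10 : z ≤ y * z ^ 9 := by nlinarith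
    calc 200 * (r : ℝ) ^ 4 * (3 * σ + 2 * (3 * z) + 9) ≤ z * z ^ 4 * (z * (y * z ^ 9)) := by
          gcongr
          · linarith
          · nlinarith
      _ = y * z ^ 15 := by ring
      _ ≤ y * y := by gcongr; exact hzy 15 (by norm_num)
      _ = y ^ 2 := by ring
      _ ≤ _ := hyy (by norm_num)
  · have h9 : 1 ≤ z ^ 9 := one_le_pow₀ hz1
    have h10 : z ≤ y * z ^ 9 := by nlinarith
    have h5 : z ^ 5 ≤ y * z ^ 9 := by
      nlinarith [hzy 5 (by norm_num)]
    calc 2 * (q : ℝ) ^ 2 + q * (σ + 3 * z) = q * (2 * q + σ + 3 * z) := by ring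
      _ ≤ z ^ 5 * (z * (y * z ^ 9)) := by
          gcongr
          nlinarith
      _ = y * z ^ 15 := by ring
      _ ≤ y * y := by gcongr; exact hzy 15 (by norm_num)
      _ = y ^ 2 := by ring
      _ ≤ _ := hyy (by norm_num)

lemma le_pow_of_large {a b m u y z : ℝ} (hz : 3000 ≤ z) (hy : z ^ 20 ≤ y) (ha : a ≤ z ^ 11)
    (hb : b + 5 ≤ z) (hm : y ^ 60 ≤ m) (hu : 0 ≤ u) (huy : u ≤ y ^ 102) (hu1 : 1 ≤ u) :
    u * a + u * (3 * z + 3) + b * u * z + 1 ≤ m ^ 2 / 2 := by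
  have hz1 : 1 ≤ z := by linarith
  have hy1 : 2 ≤ y := by linarith [le_self_pow₀ hz1 (show 20 ≠ 0 by norm_num)]
  have h5 : y ^ 120 ≤ m ^ 2 := by
    calc y ^ 120 = (y ^ 60) ^ 2 := by ring
      _ ≤ _ := by gcongr
  have h6 : a + (3 * z + 3) + b * z + 1 ≤ z ^ 20 := by
    have h2 : z ^ 2 ≤ z ^ 11 := pow_le_pow_right₀ hz1 (by norm_num)
    calc a + (3 * z + 3) + b * z + 1 ≤ z ^ 11 + z ^ 2 := by nlinarith
      _ ≤ z * z ^ 11 := by nlinarith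
      _ = z ^ 12 := by ring
      _ ≤ _ := pow_le_pow_right₀ hz1 (by norm_num)
  have h7 : u * (a + (3 * z + 3) + b * z + 1) ≤ y ^ 103 := by
    calc u * (a + (3 * z + 3) + b * z + 1) ≤ u * y :=
          mul_le_mul_of_nonneg_left (h6.trans hy) hu
      _ ≤ y ^ 102 * y := by gcongr
      _ = y ^ 103 := by ring
  have h8 : 2 * y ^ 103 ≤ y ^ 120 := by
    calc 2 * y ^ 103 ≤ y * y ^ 103 := by gcongr
      _ = y ^ 104 := by ring
      _ ≤ _ := pow_le_pow_right₀ (by linarith) (by norm_num)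
  have h9 : u * (a + (3 * z + 3) + b * z + 1) =
    u * a + u * (3 * z + 3) + b * u * z + u := by ring
  linarith

lemma exists_card_stubborn_le_of_large {r : ℕ} {y z β : ℝ} {s : Finset V} (hβ : 0 ≤ β)
    (hz : 3000 ≤ z) (hβz : 400 * (β + 5) + 1 ≤ z) (hy : z ^ 20 ≤ y) (hr : 1 ≤ r)
    (hrz : (r : ℝ) ≤ z) (hpow : z ^ (5 * r) ≤ y) (hexp : y ^ 200 ≤ 2 ^ (3 * z))
    (hu : y ^ 100 ≤ s.card) (hu' : (s.card : ℝ) + 1 ≤ y ^ 102) :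
    ∃ l : ℕ, (l * (1000 * r ^ 4 : ℕ) : ℝ) ≤ z ^ 11 ∧ ((stubborn (1000 * r ^ 4) r l s).card : ℝ) ≤
      2 ^ (turanExp r s.card - β * s.card * z - 1) := by
  obtain ⟨σ, H⟩ := admissible_of_large hz hy hr hrz hpow hexp hu'
  have hz1 : 1 ≤ z := by linarith
  have hz0 : 0 ≤ z := by linarith
  have hzy : ∀ i ≤ 20, z ^ i ≤ y := fun i hi => (pow_le_pow_right₀ hz1 hi).trans hy
  have hy1 : 3000 ≤ y := hz.trans (by simpa using hzy 1 (by norm_num))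
  have hr1 : (1 : ℝ) ≤ r := by exact_mod_cast hr
  have hrz4 : (r : ℝ) ^ 4 ≤ z ^ 4 := by gcongr
  have hyy : ∀ {i j : ℕ}, i ≤ j → y ^ i ≤ y ^ j := fun h => pow_le_pow_right₀ (by linarith) h
  have hqz : ((1000 * r ^ 4 : ℕ) : ℝ) ≤ z ^ 5 := by
    push_cast
    calc 1000 * (r : ℝ) ^ 4 ≤ z * z ^ 4 := by
          gcongr
          linarith
      _ = z ^ 5 := by ring
  obtain ⟨l, hl1, hl2⟩ : ∃ l : ℕ, 400 * (r : ℝ) ^ 4 * ((β + 5) * z) ≤ l ∧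
      (l : ℝ) ≤ 400 * (r : ℝ) ^ 4 * ((β + 5) * z) + 1 :=
    ⟨_, Nat.le_ceil _, (Nat.ceil_lt_add_one (by positivity)).le⟩
  have hl3 : (l : ℝ) ≤ z ^ 6 := by
    have h5 : 1 ≤ z ^ 5 := one_le_pow₀ hz1
    calc (l : ℝ) ≤ 400 * (r : ℝ) ^ 4 * ((β + 5) * z) + 1 := hl2
      _ ≤ 400 * z ^ 4 * ((β + 5) * z) + 1 := by gcongr
      _ = 400 * (β + 5) * z ^ 5 + 1 := by ring
      _ ≤ (z - 1) * z ^ 5 + z ^ 5 := by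
        gcongr
        linarith
      _ = z ^ 6 := by ring
  have hlq : (l * (1000 * r ^ 4 : ℕ) : ℝ) ≤ z ^ 11 := by
    calc (l * (1000 * r ^ 4 : ℕ) : ℝ) ≤ z ^ 6 * z ^ 5 := by gcongr
      _ = z ^ 11 := by ring
  have hlqy := hlq.trans (hzy 11 (by norm_num))
  have hy2 : 2 * y ^ 25 ≤ s.card := by
    calc 2 * y ^ 25 ≤ y * y ^ 25 := by gcongr; linarith
      _ = y ^ 26 := by ring
      _ ≤ y ^ 100 := hyy (by norm_num)
      _ ≤ s.card := hu
  have hy25 : y ≤ y ^ 25 := by simpa using hyy (show 1 ≤ 25 by norm_num)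
  have hu0 : (1 : ℝ) ≤ s.card := by linarith
  have huz : (s.card : ℝ) ≤ s.card * z := le_mul_of_one_le_right (by linarith) hz1
  refine ⟨l, hlq, (H.card_stubborn_le (Λ := s.card * (3 * z + 1)) (w₁ := s.card / 2) ?_ ?_ ?_ l
    le_rfl ?_).trans (Real.rpow_le_rpow_of_exponent_le one_le_two ?_)⟩
  · calc (y ^ 25) ^ 2 = y ^ 50 := by ring
      _ ≤ y ^ 100 := hyy (by norm_num)
      _ ≤ s.card := hu
      _ ≤ _ := le_mul_of_one_le_right (by linarith) (by linarith)
  · rw [mul_add, mul_one]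
    gcongr
  · linarith
  · linarith
  · have h4 : s.card * ((β + 5) * z) ≤ l * (s.card / 2 / (200 * (r : ℝ) ^ 4)) := by
      rw [div_div, ← mul_div_assoc, le_div_iff₀ (by positivity)]
      calc s.card * ((β + 5) * z) * (2 * (200 * (r : ℝ) ^ 4)) =
            400 * (r : ℝ) ^ 4 * ((β + 5) * z) * s.card := by ring
        _ ≤ _ := by gcongr
    have h5 : s.card * ((β + 5) * z) = β * s.card * z + 5 * (s.card * z) := by ring
    have h6 : s.card * (3 * z + 1) = 3 * (s.card * z) + s.card := by ring
    linarith

lemma card_farFree_le_of_large {r : ℕ} {t y z β : ℝ} {s : Finset V} (hβ : 0 ≤ β) (hz : 3000 ≤ z)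
    (hβz : 400 * (β + 5) + 1 ≤ z) (hy : z ^ 20 ≤ y) (hr : 1 ≤ r) (hrz : (r : ℝ) ≤ z)
    (hpow : z ^ (5 * r) ≤ y) (hexp : y ^ 200 ≤ 2 ^ (3 * z)) (hu : y ^ 100 ≤ s.card)
    (hu' : (s.card : ℝ) + 1 ≤ y ^ 102) (ht : y ^ 75 ≤ t) :
    ((farFree r t s).card : ℝ) ≤ 2 ^ (turanExp r s.card - β * s.card * z) := by
  obtain ⟨l, hlq, hst⟩ := exists_card_stubborn_le_of_large hβ hz hβz hy hr hrz hpow hexp hu hu'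
  have hz1 : 1 ≤ z := by linarith
  have hzy : ∀ i ≤ 20, z ^ i ≤ y := fun i hi => (pow_le_pow_right₀ hz1 hi).trans hy
  have hzy1 : z ≤ y := by simpa using hzy 1 (by norm_num)
  have hy1 : 3000 ≤ y := hz.trans hzy1
  have hyy : ∀ {i j : ℕ}, i ≤ j → y ^ i ≤ y ^ j := fun h => pow_le_pow_right₀ (by linarith) h
  have hlqy := hlq.trans (hzy 11 (by norm_num))
  have hu0 : (1 : ℝ) ≤ s.card := (one_le_pow₀ (by linarith)).trans hu
  have hy60 : 1 ≤ y ^ 60 := one_le_pow₀ (by linarith)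
  obtain ⟨m, hm1, hm2⟩ : ∃ m : ℕ, y ^ 60 ≤ m ∧ (m : ℝ) ≤ y ^ 60 + 1 :=
    ⟨_, Nat.le_ceil _, (Nat.ceil_lt_add_one (by positivity)).le⟩
  obtain ⟨L, hL1, hL2⟩ : ∃ L : ℕ, 6 * z ≤ L ∧ (L : ℝ) ≤ 6 * z + 1 :=
    ⟨_, Nat.le_ceil _, (Nat.ceil_lt_add_one (by positivity)).le⟩
  have hLr : (L : ℝ) ^ r ≤ y := by
    calc (L : ℝ) ^ r ≤ (z ^ 2) ^ r := by
          gcongr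
          nlinarith
      _ = z ^ (2 * r) := by rw [pow_mul]
      _ ≤ z ^ (5 * r) := pow_le_pow_right₀ hz1 (by omega)
      _ ≤ y := hpow
  have hD : ((r * m * L ^ r : ℕ) : ℝ) ≤ y ^ 63 := by
    push_cast
    calc (r : ℝ) * m * L ^ r ≤ y * (y * y ^ 60) * y := by
          gcongr
          · exact hrz.trans hzy1
          · nlinarith
      _ = y ^ 63 := by ring
  have hlg : (s.card : ℝ) + 1 ≤ 2 ^ (3 * z) := hu'.trans ((hyy (by norm_num)).trans hexp)
  have hrlg : (r : ℝ) ≤ 2 ^ (3 * z) := by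
    calc (r : ℝ) ≤ y ^ 1 := by rw [pow_one]; exact hrz.trans hzy1
      _ ≤ y ^ 200 := hyy (by norm_num)
      _ ≤ _ := hexp
  have h2 := card_farFree_le (l := l) (m := m) (L := L) (D := r * m * L ^ r) (t := t) hr hlg hrlg
    (by linarith) (by exact_mod_cast (show (1 : ℝ) ≤ L by linarith))
    (by exact_mod_cast hy60.trans hm1) (Nat.le_succ _) (q := 1000 * r ^ 4) ?_
  · have h4 := le_pow_of_large hz hy hlq (b := β) (by linarith) hm1 (by linarith) (by linarith) hu0
    have h6 : (2 : ℝ) ^ (turanExp r s.card - (m : ℝ) ^ 2 / 2 + l * (1000 * r ^ 4 : ℕ) * s.card +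
        s.card * (3 * z + 3)) ≤ 2 ^ (turanExp r s.card - β * s.card * z - 1) :=
      Real.rpow_le_rpow_of_exponent_le one_le_two (by linarith)
    refine (h2.trans (add_le_add hst h6)).trans_eq ?_
    rw [Real.rpow_sub two_pos _ 1, Real.rpow_one]
    ring
  · have h63 : y ≤ y ^ 63 := by simpa using hyy (show 1 ≤ 63 by norm_num)
    calc (l * (1000 * r ^ 4 : ℕ) * (l * (1000 * r ^ 4 : ℕ) + (r * m * L ^ r : ℕ)) : ℝ) ≤
          y * (y + y ^ 63) := by gcongr
      _ ≤ y * (y * y ^ 63) := by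
        gcongr
        nlinarith
      _ = y ^ 65 := by ring
      _ ≤ y ^ 75 := hyy (by norm_num)
      _ ≤ t := ht

end Parameters

lemma exists_large_log (K : ℝ) : ∃ N : ℕ, ∀ n : ℕ, N ≤ n → 1 ≤ n ∧ K ≤ Real.log (Real.log n) ∧
    Real.log (Real.log n) ^ 20 ≤ Real.log n ^ (1 / 100 : ℝ) := by
  have h1 : Filter.Tendsto (fun n : ℕ => Real.log n) Filter.atTop Filter.atTop :=
    Real.tendsto_log_atTop.comp tendsto_natCast_atTop_atTop
  have h2 : ∀ᶠ x : ℝ in Filter.atTop, Real.log x ^ 20 ≤ x ^ (1 / 100 : ℝ) := by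
    have h := (isLittleO_log_rpow_rpow_atTop (20 : ℝ)
      (by norm_num : (0 : ℝ) < 1 / 100)).bound one_pos
    filter_upwards [h, Filter.eventually_ge_atTop 1] with x hx hx1
    rw [one_mul, Real.norm_of_nonneg (by positivity [Real.log_nonneg hx1]),
      Real.norm_of_nonneg (by positivity)] at hx
    exact_mod_cast hx
  obtain ⟨N, hN⟩ := Filter.eventually_atTop.1 ((Filter.eventually_ge_atTop 1).and
    ((h1.eventually (Real.tendsto_log_atTop.eventually_ge_atTop K)).and (h1.eventually h2)))
  exact ⟨N, hN⟩

lemma turanExp_le {r k u : ℕ} (hr : 1 ≤ r) (hu : k * r ≤ u) :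
    turanExp r u ≤ (u : ℝ) ^ 2 / 2 - u * k / 2 := by
  have hr0 : (0 : ℝ) < r := by exact_mod_cast hr
  have h1 : (k : ℝ) * r ≤ u := by exact_mod_cast hu
  have h2 : (k : ℝ) ≤ u / r := by rwa [le_div_iff₀ hr0]
  have h3 : (u : ℝ) * k ≤ u * (u / r) := by gcongr
  have h4 : turanExp r u = (u : ℝ) ^ 2 / 2 - u * (u / r) / 2 := by
    unfold turanExp
    field_simp
  linarith

theorem stmt13 (C A : ℝ) (hC : 0 < C) (hA : 0 < A) :
    ∃ ε₀ : ℝ, 0 < ε₀ ∧ ∃ N : ℕ, ∀ n : ℕ, N ≤ n → ∀ k r : ℕ,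
      |(k : ℝ) - 2 * Real.logb 2 n| ≤ C * Real.log (Real.log n) →
      1 ≤ r →
      (r : ℝ) ≤ ε₀ * Real.log (Real.log n) / Real.log (Real.log (Real.log n)) →
      grPr n {G | ∃ u : ℕ, k * r ≤ u ∧ u ≤ (k + 1) * r ∧
          ∃ s : Finset (Fin n), s.card = u ∧
            (G.induce (s : Set (Fin n))).CliqueFree (r + 1) ∧
            FarFromPartite G s r ((k : ℝ) ^ (3 / 4 : ℝ))} ≤
        (n : ℝ) ^ (-A) := by
  obtain ⟨N, hN⟩ := exists_large_log (3000 + 400 * (C + A + 7) + 1)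
  refine ⟨1 / 500, by norm_num, N, fun n hn k r hk hr hrz => ?_⟩
  obtain ⟨hn1, hz, hzy⟩ := hN n hn
  set x : ℝ := Real.log n with hx
  set z : ℝ := Real.log x with hzdef
  set y : ℝ := x ^ (1 / 100 : ℝ) with hy
  have hz0 : 3000 ≤ z := by linarith
  have hn0 : (0 : ℝ) < n := by exact_mod_cast hn1
  have hx0 : 0 ≤ x := Real.log_nonneg (by exact_mod_cast hn1)
  have hzx : z ≤ x - 1 := Real.log_le_sub_one_of_pos (hx0.lt_of_ne fun h => by
    rw [hzdef, ← h, Real.log_zero] at hz0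
    linarith)
  have hx1 : 3001 ≤ x := by linarith
  have hexp : Real.exp z = x := Real.exp_log (by linarith)
  have hyx : y ^ 100 = x := by
    rw [hy, ← Real.rpow_natCast, ← Real.rpow_mul hx0]
    norm_num
  clear_value y z
  have hz1 : 1 ≤ z := by linarith
  have hzpow : ∀ i ≤ 20, z ^ i ≤ y := fun i hi => (pow_le_pow_right₀ hz1 hi).trans hzy
  have hy1 : 1 ≤ y := (one_le_pow₀ hz1).trans hzy
  have hy_le : y ≤ x := by
    rw [← hyx]
    exact le_self_pow₀ hy1 (by norm_num)
  have hCz : C * z ≤ x := by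
    calc C * z ≤ z * z := by gcongr; linarith
      _ = z ^ 2 := by ring
      _ ≤ x := (hzpow 2 (by norm_num)).trans hy_le
  set B : ℝ := Real.logb 2 n with hB
  have hlog2 : 0.69 < Real.log 2 := by linarith [Real.log_two_gt_d9]
  have hlog2' : Real.log 2 < 0.7 := by linarith [Real.log_two_lt_d9]
  have hBx : B * Real.log 2 = x := by
    rw [hB, Real.logb, div_mul_cancel₀ _ (by linarith)]
  have hB1 : x ≤ B := by nlinarith
  have hB2 : B ≤ 1.5 * x := by nlinarith
  have h2B : (2 : ℝ) ^ B = n := Real.rpow_logb (by norm_num) (by norm_num) hn0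
  clear_value B x
  obtain ⟨hk1, hk2⟩ := abs_le.1 hk
  have hkB : B ≤ k := by linarith
  have hlogz : 1 ≤ Real.log z := by
    rw [Real.le_log_iff_exp_le (by linarith)]
    linarith [Real.exp_one_lt_d9]
  have hrlog : (r : ℝ) * Real.log z ≤ 1 / 500 * z := by
    rwa [le_div_iff₀ (by linarith)] at hrz
  have hr0 : (0 : ℝ) ≤ r := by positivity
  have hrz' : (r : ℝ) ≤ z := by nlinarith
  have hpow : z ^ (5 * r) ≤ y := by
    calc z ^ (5 * r) = Real.exp (Real.log z * (5 * r : ℕ)) := by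
          rw [← Real.rpow_natCast, Real.rpow_def_of_pos (by linarith)]
      _ ≤ Real.exp (z * (1 / 100)) := by
          refine Real.exp_le_exp.2 ?_
          push_cast
          linarith
      _ = y := by rw [Real.exp_mul, hexp, hy]
  have hexp2 : y ^ 200 ≤ (2 : ℝ) ^ (3 * z) := by
    calc y ^ 200 = (y ^ 100) ^ 2 := by ring
      _ = Real.exp (z * (2 : ℕ)) := by rw [Real.exp_mul, hexp, Real.rpow_natCast, hyx]
      _ ≤ Real.exp (Real.log 2 * (3 * z)) := by
          refine Real.exp_le_exp.2 ?_
          push_cast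
          nlinarith
      _ = _ := by rw [Real.rpow_def_of_pos (by norm_num)]
  have ht : y ^ 75 ≤ (k : ℝ) ^ (3 / 4 : ℝ) := by
    calc y ^ 75 = (y ^ 100) ^ (3 / 4 : ℝ) := by
          rw [← Real.rpow_natCast y 75, ← Real.rpow_natCast y 100, ← Real.rpow_mul (by linarith)]
          congr 1
          norm_num
      _ ≤ _ := by
          rw [hyx]
          gcongr
          linarith
  refine (grPr_exists_far_le (M := (n : ℝ) ^ (-(A + 1))) hr hn1 (by positivity)
    fun u hu1 hu2 s hs => ?_).trans ?_
  · have hku : (k : ℝ) ≤ u := by exact_mod_cast (Nat.le_mul_of_pos_right k hr).trans hu1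
    have hu0 : (1 : ℝ) ≤ u := by linarith
    have h1 : ((farFree r ((k : ℝ) ^ (3 / 4 : ℝ)) s).card : ℝ) ≤
        2 ^ (turanExp r u - (C + A + 2) * u * z) := by
      have := card_farFree_le_of_large (s := s) (β := C + A + 2) (by linarith) hz0
        (by linarith) hzy hr hrz' hpow hexp2 (by rw [hyx, hs]; linarith) ?_ ht
      · rwa [hs] at this
      · have h2 : (u : ℝ) ≤ (k + 1) * r := by exact_mod_cast hu2
        have h3 : ((k : ℝ) + 1) * r ≤ 5 * x * z := by
          gcongr
          linarith
        rw [hs]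
        calc (u : ℝ) + 1 ≤ 5 * x * z + 1 := by linarith
          _ ≤ x * z * z := by
              have h4 : 1 ≤ x * z := one_le_mul_of_one_le_of_one_le (by linarith) hz1
              have h5 : x * z * 3000 ≤ x * z * z := by gcongr
              linarith
          _ = x * z ^ 2 := by ring
          _ ≤ y ^ 100 * y := by
              rw [hyx]
              gcongr
              exact hzpow 2 (by norm_num)
          _ = y ^ 101 := by ring
          _ ≤ y ^ 102 := pow_le_pow_right₀ hy1 (by norm_num)
    have h2 : (n : ℝ) ^ u = 2 ^ (B * u) := by
      rw [Real.rpow_mul (by norm_num), h2B, Real.rpow_natCast]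
    have h3 : (n : ℝ) ^ (-(A + 1)) = 2 ^ (B * -(A + 1)) := by
      rw [Real.rpow_mul (by norm_num), h2B]
    have h4 : (2 : ℝ) ^ u.choose 2 = 2 ^ ((u : ℝ) * (u - 1) / 2) := by
      rw [← Nat.cast_choose_two ℝ u, Real.rpow_natCast]
    rw [h2, h3, h4]
    calc ((farFree r ((k : ℝ) ^ (3 / 4 : ℝ)) s).card : ℝ) * 2 ^ (B * u) ≤
          2 ^ (turanExp r u - (C + A + 2) * u * z) * 2 ^ (B * u) := by gcongr
      _ = 2 ^ (turanExp r u - (C + A + 2) * u * z + B * u) :=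
          (Real.rpow_add (by norm_num) _ _).symm
      _ ≤ 2 ^ (B * -(A + 1) + (u : ℝ) * (u - 1) / 2) := by
          refine Real.rpow_le_rpow_of_exponent_le one_le_two ?_
          have h5 := turanExp_le hr hu1
          have h6 : (u : ℝ) * (2 * B - C * z) ≤ u * k := by
            gcongr
            linarith
          have h7 : (u : ℝ) ≤ u * z := le_mul_of_one_le_right (by linarith) hz1
          have h8 : B * (A + 1) ≤ u * z * (A + 1) := by
            gcongr
            linarith
          have h9 : 0 ≤ C * (u * z) := by positivity
          linarith
      _ = _ := Real.rpow_add (by norm_num) _ _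
  · have h1 : (r : ℝ) + 1 ≤ n := by
      have := Real.log_le_sub_one_of_pos hn0
      linarith
    calc ((r : ℝ) + 1) * (n : ℝ) ^ (-(A + 1)) ≤ n * (n : ℝ) ^ (-(A + 1)) := by gcongr
      _ = (n : ℝ) ^ (1 + -(A + 1)) := by rw [Real.rpow_add hn0, Real.rpow_one]
      _ = _ := by ring_nf
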